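/- Let n ≥ 3 be an integer, let D be a digraph satisfying (D'1), (D2) and (D3), let Q = v_1 v_2 ⋯ v_l be an induced directed path in D, and let Y' be a subset of N_{G_D}(V(Q)) such that N_{G_D}(y) ∩ V(Q) ⊆ {v_i : n+1 ≤ i ≤ l−n} for every y ∈ Y'. Then pp(D[V(Q) ∪ Y']) ≤ n(n+5)/2 + 1, and moreover pp(D[(V(Q) \ {v_t}) ∪ Y']) ≤ n(n+5)/2 + 1 for each t ∈ {1, l}. -/

import Mathlib

/-! ## Basic notions for graphs and digraphs

A digraph on a vertex type `V` is given by its arc relation `E : V → V → Prop`.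
Simplicity and absence of 2-cycles is expressed by the hypothesis
`∀ u v, E u v → ¬ E v u`.  The underlying graph `G_D` is `SimpleGraph.fromRel E`. -/

/-- `G` contains an induced copy of the simple graph `H`. -/
def HasInducedCopyG {W V : Type} (H : SimpleGraph W) (G : SimpleGraph V) : Prop :=
  ∃ f : W → V, Function.Injective f ∧ ∀ a b : W, G.Adj (f a) (f b) ↔ H.Adj a b

/-- The digraph `E` contains an induced copy of the digraph `H`. -/
def DigraphHasInducedCopy {W V : Type} (H : W → W → Prop) (E : V → V → Prop) : Prop :=
  ∃ f : W → V, Function.Injective f ∧ ∀ a b : W, E (f a) (f b) ↔ H a b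

/-- The star `K_{1,n}` with one center and `n` leaves. -/
def StarG (n : ℕ) : SimpleGraph (Unit ⊕ Fin n) :=
  SimpleGraph.fromRel (fun a b =>
    match a, b with
    | Sum.inl _, Sum.inr _ => True
    | _, _ => False)

/-- The path `P_n` of order `n`. -/
def PathG (n : ℕ) : SimpleGraph (Fin n) :=
  SimpleGraph.fromRel (fun i j => i.val + 1 = j.val)

/-- The graph `K*_n`: a complete graph on the `x_i` together with pendant edges `x_i y_i`. -/
def KStarG (n : ℕ) : SimpleGraph (Fin n ⊕ Fin n) :=
  SimpleGraph.fromRel (fun a b =>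
    match a, b with
    | Sum.inl i, Sum.inl j => i ≠ j
    | Sum.inl i, Sum.inr j => i = j
    | _, _ => False)

/-- The graph `F^(1)_n` on `{x₁,x₂} ∪ {yᵢ} ∪ {zᵢ}`:
edges `x₁x₂, x₁y₁, x₁z₁` together with the two paths `y₁⋯y_n` and `z₁⋯z_n`. -/
def F1G (n : ℕ) : SimpleGraph (Fin 2 ⊕ Fin n ⊕ Fin n) :=
  SimpleGraph.fromRel (fun a b =>
    match a, b with
    | Sum.inl i, Sum.inl j => i.val = 0 ∧ j.val = 1
    | Sum.inl i, Sum.inr (Sum.inl j) => i.val = 0 ∧ j.val = 0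
    | Sum.inl i, Sum.inr (Sum.inr j) => i.val = 0 ∧ j.val = 0
    | Sum.inr (Sum.inl i), Sum.inr (Sum.inl j) => i.val + 1 = j.val
    | Sum.inr (Sum.inr i), Sum.inr (Sum.inr j) => i.val + 1 = j.val
    | _, _ => False)

/-- The single edge `y₁z₁` (used to build `F^(2)_n` and `F^(4)_n`). -/
def YZEdgeG (n : ℕ) : SimpleGraph (Fin 2 ⊕ Fin n ⊕ Fin n) :=
  SimpleGraph.fromRel (fun a b =>
    match a, b with
    | Sum.inr (Sum.inl i), Sum.inr (Sum.inr j) => i.val = 0 ∧ j.val = 0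
    | _, _ => False)

/-- `F^(2)_n = F^(1)_n + y₁z₁`. -/
def F2G (n : ℕ) : SimpleGraph (Fin 2 ⊕ Fin n ⊕ Fin n) := F1G n ⊔ YZEdgeG n

/-- The graph `F^(3)_n`: edges `x₁y₁, x₁z₁, x₂y₁, x₂z₁` together with the two paths. -/
def F3G (n : ℕ) : SimpleGraph (Fin 2 ⊕ Fin n ⊕ Fin n) :=
  SimpleGraph.fromRel (fun a b =>
    match a, b with
    | Sum.inl _, Sum.inr (Sum.inl j) => j.val = 0
    | Sum.inl _, Sum.inr (Sum.inr j) => j.val = 0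
    | Sum.inr (Sum.inl i), Sum.inr (Sum.inl j) => i.val + 1 = j.val
    | Sum.inr (Sum.inr i), Sum.inr (Sum.inr j) => i.val + 1 = j.val
    | _, _ => False)

/-- `F^(4)_n = F^(3)_n + y₁z₁`. -/
def F4G (n : ℕ) : SimpleGraph (Fin 2 ⊕ Fin n ⊕ Fin n) := F3G n ⊔ YZEdgeG n

/-- The digraph `D^(1)_n` on `{x₁} ∪ {yᵢ} ∪ {zᵢ}` with arcs
`(x₁,y₁), (z₁,x₁), (y₁,z₁)`, `(y_{i+1}, y_i)` and `(z_i, z_{i+1})`. -/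
def D1Rel (n : ℕ) : (Unit ⊕ Fin n ⊕ Fin n) → (Unit ⊕ Fin n ⊕ Fin n) → Prop := fun a b =>
  match a, b with
  | Sum.inl _, Sum.inr (Sum.inl j) => j.val = 0
  | Sum.inr (Sum.inr i), Sum.inl _ => i.val = 0
  | Sum.inr (Sum.inl i), Sum.inr (Sum.inr j) => i.val = 0 ∧ j.val = 0
  | Sum.inr (Sum.inl i), Sum.inr (Sum.inl j) => j.val + 1 = i.val
  | Sum.inr (Sum.inr i), Sum.inr (Sum.inr j) => i.val + 1 = j.val
  | _, _ => False

/-- `D^(2)_n`: obtained from `D^(1)_n` by replacing the arc `(z₁,x₁)` by `(x₁,z₁)`. -/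
def D2Rel (n : ℕ) : (Unit ⊕ Fin n ⊕ Fin n) → (Unit ⊕ Fin n ⊕ Fin n) → Prop := fun a b =>
  match a, b with
  | Sum.inl _, Sum.inr (Sum.inl j) => j.val = 0
  | Sum.inl _, Sum.inr (Sum.inr j) => j.val = 0
  | Sum.inr (Sum.inl i), Sum.inr (Sum.inr j) => i.val = 0 ∧ j.val = 0
  | Sum.inr (Sum.inl i), Sum.inr (Sum.inl j) => j.val + 1 = i.val
  | Sum.inr (Sum.inr i), Sum.inr (Sum.inr j) => i.val + 1 = j.val
  | _, _ => False

/-- `D^(3)_n`: obtained from `D^(1)_n` by replacing the arc `(x₁,y₁)` by `(y₁,x₁)`. -/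
def D3Rel (n : ℕ) : (Unit ⊕ Fin n ⊕ Fin n) → (Unit ⊕ Fin n ⊕ Fin n) → Prop := fun a b =>
  match a, b with
  | Sum.inr (Sum.inl i), Sum.inl _ => i.val = 0
  | Sum.inr (Sum.inr i), Sum.inl _ => i.val = 0
  | Sum.inr (Sum.inl i), Sum.inr (Sum.inr j) => i.val = 0 ∧ j.val = 0
  | Sum.inr (Sum.inl i), Sum.inr (Sum.inl j) => j.val + 1 = i.val
  | Sum.inr (Sum.inr i), Sum.inr (Sum.inr j) => i.val + 1 = j.val
  | _, _ => False

/-- The transitive tournament `T_n`. -/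
def TRel (n : ℕ) : Fin n → Fin n → Prop := fun i j => i < j

/-- A (nonempty) directed path in the digraph `E`, recorded as its list of vertices. -/
def IsDirPathList {V : Type} (E : V → V → Prop) (l : List V) : Prop :=
  l ≠ [] ∧ l.Nodup ∧ l.Chain' E

/-- The path cover number of the subdigraph of `E` induced by `X`:
the minimum number of directed paths of `E[X]` whose vertex sets cover `X`. -/
noncomputable def pcOn {V : Type} (E : V → V → Prop) (X : Set V) : ℕ :=
  sInf {k | ∃ P : Finset (List V), P.card = k ∧
    (∀ l ∈ P, IsDirPathList E l ∧ ∀ v ∈ l, v ∈ X) ∧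
    ∀ v ∈ X, ∃ l ∈ P, v ∈ l}

/-- The path partition number of the subdigraph of `E` induced by `X`:
the minimum number of pairwise vertex-disjoint directed paths of `E[X]`
whose vertex sets partition `X`. -/
noncomputable def ppOn {V : Type} (E : V → V → Prop) (X : Set V) : ℕ :=
  sInf {k | ∃ P : Finset (List V), P.card = k ∧
    (∀ l ∈ P, IsDirPathList E l ∧ ∀ v ∈ l, v ∈ X) ∧
    (∀ v ∈ X, ∃ l ∈ P, v ∈ l) ∧
    ∀ l ∈ P, ∀ l' ∈ P, l ≠ l' → ∀ v ∈ l, v ∉ l'}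

/-- A (nonempty) path in the simple graph `G`, recorded as its list of vertices. -/
def IsPathList {V : Type} (G : SimpleGraph V) (l : List V) : Prop :=
  l ≠ [] ∧ l.Nodup ∧ l.Chain' G.Adj

/-- The path cover number `pc(G)` of a simple graph `G`. -/
noncomputable def pcG {V : Type} (G : SimpleGraph V) : ℕ :=
  sInf {k | ∃ P : Finset (List V), P.card = k ∧
    (∀ l ∈ P, IsPathList G l) ∧ ∀ v : V, ∃ l ∈ P, v ∈ l}

/-- The path partition number `pp(G)` of a simple graph `G`. -/
noncomputable def ppG {V : Type} (G : SimpleGraph V) : ℕ :=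
  sInf {k | ∃ P : Finset (List V), P.card = k ∧
    (∀ l ∈ P, IsPathList G l) ∧ (∀ v : V, ∃ l ∈ P, v ∈ l) ∧
    ∀ l ∈ P, ∀ l' ∈ P, l ≠ l' → ∀ v ∈ l, v ∉ l'}

/-- A directed cycle in the digraph `E`, recorded as its list of vertices. -/
def IsDirCycleList {V : Type} (E : V → V → Prop) (l : List V) : Prop :=
  ∃ h : l ≠ [], 3 ≤ l.length ∧ l.Nodup ∧ l.Chain' E ∧ E (l.getLast h) (l.head h)

/-- A member of a cycle cover/partition: a directed cycle, or a weakly connected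
subdigraph of order at most two. -/
def IsCyclePartMember {V : Type} (E : V → V → Prop) (l : List V) : Prop :=
  IsDirCycleList E l ∨
    (l ≠ [] ∧ l.length ≤ 2 ∧ l.Nodup ∧ l.Chain' (fun a b => E a b ∨ E b a))

/-- The cycle partition number `cp(D)` of the digraph `E`. -/
noncomputable def cpNum {V : Type} (E : V → V → Prop) : ℕ :=
  sInf {k | ∃ P : Finset (List V), P.card = k ∧
    (∀ l ∈ P, IsCyclePartMember E l) ∧
    (∀ v : V, ∃ l ∈ P, v ∈ l) ∧
    ∀ l ∈ P, ∀ l' ∈ P, l ≠ l' → ∀ v ∈ l, v ∉ l'}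

/-- `v : Fin m → V` enumerates an induced path of the simple graph `G`. -/
def IsInducedPathEmb {V : Type} (G : SimpleGraph V) {m : ℕ} (v : Fin m → V) : Prop :=
  Function.Injective v ∧
    ∀ i j : Fin m, G.Adj (v i) (v j) ↔ (i.val + 1 = j.val ∨ j.val + 1 = i.val)

/-- `w : Fin m → V` enumerates an induced pseudo-path of the digraph `E`:
the induced subdigraph on its image has a path as underlying graph. -/
def IsInducedPsPath {V : Type} (E : V → V → Prop) {m : ℕ} (w : Fin m → V) : Prop :=
  Function.Injective w ∧
    ∀ i j : Fin m, (E (w i) (w j) ∨ E (w j) (w i)) ↔ (i.val + 1 = j.val ∨ j.val + 1 = i.val)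

/-- `r(P)` for a pseudo-path enumerated by `w`: the number of (internal) vertices
having out-degree 2 or in-degree 2 in the pseudo-path. -/
noncomputable def turnCount {V : Type} (E : V → V → Prop) {m : ℕ} (w : Fin m → V) : ℕ :=
  Set.ncard {i : Fin m | ∃ j k : Fin m, j.val + 1 = i.val ∧ i.val + 1 = k.val ∧
    ((E (w i) (w j) ∧ E (w i) (w k)) ∨ (E (w j) (w i) ∧ E (w k) (w i)))}

/-- Condition (D1): the underlying graph of `E` is `{K*_n, K_{1,n}, F^(1)_n, F^(2)_n}`-free. -/
def CondD1 {V : Type} (n : ℕ) (E : V → V → Prop) : Prop :=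
  ¬ HasInducedCopyG (KStarG n) (SimpleGraph.fromRel E) ∧
  ¬ HasInducedCopyG (StarG n) (SimpleGraph.fromRel E) ∧
  ¬ HasInducedCopyG (F1G n) (SimpleGraph.fromRel E) ∧
  ¬ HasInducedCopyG (F2G n) (SimpleGraph.fromRel E)

/-- Condition (D'1): the underlying graph of `E` is
`{K*_n, K_{1,n}, F^(1)_n, F^(2)_n, F^(3)_n, F^(4)_n}`-free. -/
def CondD1' {V : Type} (n : ℕ) (E : V → V → Prop) : Prop :=
  CondD1 n E ∧
  ¬ HasInducedCopyG (F3G n) (SimpleGraph.fromRel E) ∧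
  ¬ HasInducedCopyG (F4G n) (SimpleGraph.fromRel E)

/-- Condition (D2): `E` is `{D^(1)_n, D^(2)_n, D^(3)_n}`-free. -/
def CondD2 {V : Type} (n : ℕ) (E : V → V → Prop) : Prop :=
  ¬ DigraphHasInducedCopy (D1Rel n) E ∧
  ¬ DigraphHasInducedCopy (D2Rel n) E ∧
  ¬ DigraphHasInducedCopy (D3Rel n) E

/-- Condition (D3): `r(P) ≤ n` for every induced pseudo-path `P` of `E`. -/
def CondD3 {V : Type} (n : ℕ) (E : V → V → Prop) : Prop :=
  ∀ (m : ℕ) (w : Fin m → V), IsInducedPsPath E w → turnCount E w ≤ n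

/-- The Ramsey number `R(a, b)`: the least `R` such that every graph on at least `R`
vertices contains a clique of size `a` or an independent set of size `b`. -/
noncomputable def ramseyNumber (a b : ℕ) : ℕ :=
  sInf {R | ∀ m : ℕ, R ≤ m → ∀ G : SimpleGraph (Fin m),
    (∃ s : Finset (Fin m), G.IsNClique a s) ∨ (∃ s : Finset (Fin m), Gᶜ.IsNClique b s)}

/-- The independence number of the subgraph of `G` induced by `X`. -/
noncomputable def indepNumOn {V : Type} (G : SimpleGraph V) (X : Set V) : ℕ :=
  sSup {k | ∃ s : Finset V, ↑s ⊆ X ∧ s.card = k ∧ ∀ a ∈ s, ∀ b ∈ s, a ≠ b → ¬ G.Adj a b}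

/-- The independence number `α(G)`. -/
noncomputable def indepNum {V : Type} (G : SimpleGraph V) : ℕ := indepNumOn G Set.univ

/-- The neighborhood `N_G(X)` of a set of vertices. -/
def nbhd {V : Type} (G : SimpleGraph V) (X : Set V) : Set V :=
  {v | v ∉ X ∧ ∃ x ∈ X, G.Adj v x}

/-! ## Adjacency and forbidden configurations -/

/-- Adjacency in the underlying graph of the digraph `E`. -/
def UAdj {V : Type} (E : V → V → Prop) (x y : V) : Prop := E x y ∨ E y x

theorem UAdj.symm {V : Type} {E : V → V → Prop} {x y : V} (h : UAdj E x y) : UAdj E y x :=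
  Or.symm h

theorem uAdj_comm {V : Type} {E : V → V → Prop} {x y : V} : UAdj E x y ↔ UAdj E y x :=
  Or.comm

theorem UAdj.ne {V : Type} {E : V → V → Prop} (hE : ∀ u v : V, E u v → ¬ E v u) {x y : V}
    (h : UAdj E x y) : x ≠ y := by
  rintro rfl
  exact hE x x (h.elim id id) (h.elim id id)

theorem fromRel_adj_iff_uAdj {V : Type} {E : V → V → Prop} (hE : ∀ u v : V, E u v → ¬ E v u)
    {x y : V} : (SimpleGraph.fromRel E).Adj x y ↔ UAdj E x y :=
  ⟨fun h => h.2, fun h => ⟨h.ne hE, h⟩⟩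

/-- A sequence that is an induced path of length at least three with some vertex attached to its
first vertex only has no repetitions. -/
theorem arm_injective {V : Type} {E : V → V → Prop} {n : ℕ} {x : V} {p : ℕ → V}
    (hxp : ∀ i < n, UAdj E x (p i) ↔ i = 0)
    (hp : ∀ i < n, ∀ j < n, UAdj E (p i) (p j) ↔ i + 1 = j ∨ j + 1 = i)
    {i j : ℕ} (hi : i < n) (hj : j < n) (h : p i = p j) : i = j := by
  wlog hij : i < j generalizing i j
  · by_contra hne
    exact hne (this hj hi h.symm (by omega)).symm
  exfalso
  have e1 := (hp (j - 1) (by omega) j hj).2 (by omega)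
  rw [← h, hp _ (by omega) _ hi] at e1
  rcases Nat.eq_zero_or_pos i with rfl | hpos
  · have := (hxp 0 hi).2 rfl
    rw [h, hxp _ hj] at this
    omega
  · have e2 := (hp (i - 1) (by omega) i hi).2 (by omega)
    rw [h, hp _ (by omega) _ hj] at e2
    omega

/-- Two induced arms joined at most by an edge between their first vertices are disjoint. -/
theorem arms_disjoint {V : Type} {E : V → V → Prop} {n : ℕ} (hn : 3 ≤ n) {p q : ℕ → V}
    (hp : ∀ i < n, ∀ j < n, UAdj E (p i) (p j) ↔ i + 1 = j ∨ j + 1 = i)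
    (hpq : ∀ i < n, ∀ j < n, UAdj E (p i) (q j) → i = 0 ∧ j = 0) :
    ∀ i < n, ∀ j < n, p i ≠ q j := by
  intro i hi j hj h
  have key : ∀ k < n, i + 1 = k ∨ k + 1 = i → k = 0 := by
    intro k hk hik
    have := (hp i hi k hk).2 hik
    rw [h] at this
    exact (hpq k hk j hj this.symm).1
  rcases Nat.lt_or_ge (i + 1) n with h1 | h1
  · have := key (i + 1) h1 (by omega)
    omega
  · have := key (i - 1) (by omega) (by omega)
    omega

set_option maxHeartbeats 1000000 in
/-- In an `{F^(1)_n, F^(2)_n}`-free graph there is no vertex `x` with a pendant neighbor `x'` and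
two induced arms `p`, `q` that may only be joined by an edge between their first vertices. -/
theorem no_pendant_with_arms {V : Type} {E : V → V → Prop} (hE : ∀ u v : V, E u v → ¬ E v u)
    {n : ℕ} (hn : 3 ≤ n)
    (hF1 : ¬ HasInducedCopyG (F1G n) (SimpleGraph.fromRel E))
    (hF2 : ¬ HasInducedCopyG (F2G n) (SimpleGraph.fromRel E))
    {x x' : V} {p q : ℕ → V} (hxx : UAdj E x x')
    (hxp : ∀ i < n, UAdj E x (p i) ↔ i = 0) (hxq : ∀ i < n, UAdj E x (q i) ↔ i = 0)
    (hx'p : ∀ i < n, ¬ UAdj E x' (p i)) (hx'q : ∀ i < n, ¬ UAdj E x' (q i))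
    (hp : ∀ i < n, ∀ j < n, UAdj E (p i) (p j) ↔ i + 1 = j ∨ j + 1 = i)
    (hq : ∀ i < n, ∀ j < n, UAdj E (q i) (q j) ↔ i + 1 = j ∨ j + 1 = i)
    (hpq : ∀ i < n, ∀ j < n, UAdj E (p i) (q j) → i = 0 ∧ j = 0) : False := by
  have hx0 : x ≠ x' := hxx.ne hE
  have hxnp : ∀ i < n, x ≠ p i := fun i hi h => hx'p i hi (h ▸ hxx.symm)
  have hxnq : ∀ i < n, x ≠ q i := fun i hi h => hx'q i hi (h ▸ hxx.symm)
  have hx'np : ∀ i < n, x' ≠ p i := by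
    intro i hi h
    have h0 := (hxp i hi).1 (h ▸ hxx)
    subst h0
    exact hx'p 1 (by omega) (h ▸ (hp 0 hi 1 (by omega)).2 (by omega))
  have hx'nq : ∀ i < n, x' ≠ q i := by
    intro i hi h
    have h0 := (hxq i hi).1 (h ▸ hxx)
    subst h0
    exact hx'q 1 (by omega) (h ▸ (hq 0 hi 1 (by omega)).2 (by omega))
  have hpqne := arms_disjoint hn hp hpq
  let f : Fin 2 ⊕ Fin n ⊕ Fin n → V :=
    Sum.elim (fun i => if i.val = 0 then x else x')
      (Sum.elim (fun i => p i.val) (fun i => q i.val))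
  have hf : Function.Injective f := by
    have arm := @arm_injective V E n x
    rintro (a | a | a) (b | b | b) h
    · fin_cases a <;> fin_cases b <;> simp [f, hx0, hx0.symm] at h ⊢
    · fin_cases a <;> simp [f] at h
      exacts [absurd h (hxnp _ b.2), absurd h (hx'np _ b.2)]
    · fin_cases a <;> simp [f] at h
      exacts [absurd h (hxnq _ b.2), absurd h (hx'nq _ b.2)]
    · fin_cases b <;> simp [f] at h
      exacts [absurd h.symm (hxnp _ a.2), absurd h.symm (hx'np _ a.2)]
    · have := arm hxp hp a.2 b.2 h
      simp [Fin.ext_iff, this]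
    · exact absurd h (hpqne _ a.2 _ b.2)
    · fin_cases b <;> simp [f] at h
      exacts [absurd h.symm (hxnq _ a.2), absurd h.symm (hx'nq _ a.2)]
    · exact absurd h.symm (hpqne _ b.2 _ a.2)
    · have := arm hxq hq a.2 b.2 h
      simp [Fin.ext_iff, this]
  have irr : ∀ z, ¬ UAdj E z z := fun z h => h.ne hE rfl
  by_cases h0 : UAdj E (p 0) (q 0)
  · refine hF2 ⟨f, hf, fun a b => ?_⟩
    have hpq' : ∀ i < n, ∀ j < n, UAdj E (p i) (q j) ↔ i = 0 ∧ j = 0 :=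
      fun i hi j hj => ⟨hpq i hi j hj, by rintro ⟨rfl, rfl⟩; exact h0⟩
    rw [fromRel_adj_iff_uAdj hE]
    rcases a with a | a | a <;> rcases b with b | b | b
    · fin_cases a <;> fin_cases b <;>
        simp [F2G, F1G, YZEdgeG, SimpleGraph.fromRel_adj, f, hxx, hxx.symm, irr]
    · fin_cases a <;>
        simp [F2G, F1G, YZEdgeG, SimpleGraph.fromRel_adj, f, hxp, hx'p]
    · fin_cases a <;>
        simp [F2G, F1G, YZEdgeG, SimpleGraph.fromRel_adj, f, hxq, hx'q]
    · rw [uAdj_comm]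
      fin_cases b <;>
        simp [F2G, F1G, YZEdgeG, SimpleGraph.fromRel_adj, f, hxp, hx'p]
    · simp only [F2G, F1G, YZEdgeG, SimpleGraph.sup_adj, SimpleGraph.fromRel_adj, f, Sum.elim_inr,
        Sum.elim_inl, hp _ a.2 _ b.2]
      simp [Fin.ext_iff]; omega
    · simp [F2G, F1G, YZEdgeG, SimpleGraph.fromRel_adj, f, hpq']
    · rw [uAdj_comm]
      fin_cases b <;>
        simp [F2G, F1G, YZEdgeG, SimpleGraph.fromRel_adj, f, hxq, hx'q]
    · rw [uAdj_comm]
      simp [F2G, F1G, YZEdgeG, SimpleGraph.fromRel_adj, f, hpq']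
    · simp only [F2G, F1G, YZEdgeG, SimpleGraph.sup_adj, SimpleGraph.fromRel_adj, f, Sum.elim_inr,
        hq _ a.2 _ b.2]
      simp [Fin.ext_iff]; omega
  · refine hF1 ⟨f, hf, fun a b => ?_⟩
    have hpq' : ∀ i < n, ∀ j < n, ¬ UAdj E (p i) (q j) := by
      intro i hi j hj h
      obtain ⟨rfl, rfl⟩ := hpq i hi j hj h
      exact h0 h
    rw [fromRel_adj_iff_uAdj hE]
    rcases a with a | a | a <;> rcases b with b | b | b
    · fin_cases a <;> fin_cases b <;>
        simp [F1G, SimpleGraph.fromRel_adj, f, hxx, hxx.symm, irr]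
    · fin_cases a <;> simp [F1G, SimpleGraph.fromRel_adj, f, hxp, hx'p]
    · fin_cases a <;> simp [F1G, SimpleGraph.fromRel_adj, f, hxq, hx'q]
    · rw [uAdj_comm]
      fin_cases b <;> simp [F1G, SimpleGraph.fromRel_adj, f, hxp, hx'p]
    · simp only [F1G, SimpleGraph.fromRel_adj, f, Sum.elim_inr, Sum.elim_inl, hp _ a.2 _ b.2]
      simp [Fin.ext_iff]; omega
    · simp [F1G, SimpleGraph.fromRel_adj, f, hpq']
    · rw [uAdj_comm]
      fin_cases b <;> simp [F1G, SimpleGraph.fromRel_adj, f, hxq, hx'q]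
    · rw [uAdj_comm]
      simp [F1G, SimpleGraph.fromRel_adj, f, hpq']
    · simp only [F1G, SimpleGraph.fromRel_adj, f, Sum.elim_inr, hq _ a.2 _ b.2]
      simp [Fin.ext_iff]; omega

set_option maxHeartbeats 1000000 in
/-- In an `{F^(3)_n, F^(4)_n}`-free graph there are no two distinct non-adjacent vertices `x`, `x'`
both attached to the first vertices of two induced arms `p`, `q` that may only be joined by an
edge between their first vertices. -/
theorem no_twins_with_arms {V : Type} {E : V → V → Prop} (hE : ∀ u v : V, E u v → ¬ E v u)
    {n : ℕ} (hn : 3 ≤ n)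
    (hF3 : ¬ HasInducedCopyG (F3G n) (SimpleGraph.fromRel E))
    (hF4 : ¬ HasInducedCopyG (F4G n) (SimpleGraph.fromRel E))
    {x x' : V} {p q : ℕ → V} (hne : x ≠ x') (hxx : ¬ UAdj E x x')
    (hxp : ∀ i < n, UAdj E x (p i) ↔ i = 0) (hxq : ∀ i < n, UAdj E x (q i) ↔ i = 0)
    (hx'p : ∀ i < n, UAdj E x' (p i) ↔ i = 0) (hx'q : ∀ i < n, UAdj E x' (q i) ↔ i = 0)
    (hp : ∀ i < n, ∀ j < n, UAdj E (p i) (p j) ↔ i + 1 = j ∨ j + 1 = i)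
    (hq : ∀ i < n, ∀ j < n, UAdj E (q i) (q j) ↔ i + 1 = j ∨ j + 1 = i)
    (hpq : ∀ i < n, ∀ j < n, UAdj E (p i) (q j) → i = 0 ∧ j = 0) : False := by
  have notp : ∀ z, (∀ i < n, UAdj E z (p i) ↔ i = 0) → (∀ i < n, UAdj E z (q i) ↔ i = 0) →
      ∀ i < n, z ≠ p i := by
    intro z h1 h2 i hi h
    have e1 := (h1 0 (by omega)).2 rfl
    have e2 := (h2 0 (by omega)).2 rfl
    rw [h] at e1 e2
    have := (hp i hi 0 (by omega)).1 e1
    have := hpq i hi 0 (by omega) e2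
    omega
  have notq : ∀ z, (∀ i < n, UAdj E z (p i) ↔ i = 0) → (∀ i < n, UAdj E z (q i) ↔ i = 0) →
      ∀ i < n, z ≠ q i := by
    intro z h1 h2 i hi h
    have e1 := (h1 0 (by omega)).2 rfl
    have e2 := (h2 0 (by omega)).2 rfl
    rw [h] at e1 e2
    have := (hq i hi 0 (by omega)).1 e2
    have := hpq 0 (by omega) i hi e1.symm
    omega
  have hpqne := arms_disjoint hn hp hpq
  let f : Fin 2 ⊕ Fin n ⊕ Fin n → V :=
    Sum.elim (fun i => if i.val = 0 then x else x')
      (Sum.elim (fun i => p i.val) (fun i => q i.val))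
  have hxnp := notp x hxp hxq
  have hxnq := notq x hxp hxq
  have hx'np := notp x' hx'p hx'q
  have hx'nq := notq x' hx'p hx'q
  have hf : Function.Injective f := by
    have arm := @arm_injective V E n x
    rintro (a | a | a) (b | b | b) h
    · fin_cases a <;> fin_cases b <;> simp [f, hne, hne.symm] at h ⊢
    · fin_cases a <;> simp [f] at h
      exacts [absurd h (hxnp _ b.2), absurd h (hx'np _ b.2)]
    · fin_cases a <;> simp [f] at h
      exacts [absurd h (hxnq _ b.2), absurd h (hx'nq _ b.2)]
    · fin_cases b <;> simp [f] at h
      exacts [absurd h.symm (hxnp _ a.2), absurd h.symm (hx'np _ a.2)]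
    · have := arm hxp hp a.2 b.2 h
      simp [Fin.ext_iff, this]
    · exact absurd h (hpqne _ a.2 _ b.2)
    · fin_cases b <;> simp [f] at h
      exacts [absurd h.symm (hxnq _ a.2), absurd h.symm (hx'nq _ a.2)]
    · exact absurd h.symm (hpqne _ b.2 _ a.2)
    · have := arm hxq hq a.2 b.2 h
      simp [Fin.ext_iff, this]
  have irr : ∀ z, ¬ UAdj E z z := fun z h => h.ne hE rfl
  have hxx' : ¬ UAdj E x' x := fun h => hxx h.symm
  by_cases h0 : UAdj E (p 0) (q 0)
  · refine hF4 ⟨f, hf, fun a b => ?_⟩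
    have hpq' : ∀ i < n, ∀ j < n, UAdj E (p i) (q j) ↔ i = 0 ∧ j = 0 :=
      fun i hi j hj => ⟨hpq i hi j hj, by rintro ⟨rfl, rfl⟩; exact h0⟩
    rw [fromRel_adj_iff_uAdj hE]
    rcases a with a | a | a <;> rcases b with b | b | b
    · fin_cases a <;> fin_cases b <;>
        simp [F4G, F3G, YZEdgeG, SimpleGraph.fromRel_adj, f, hxx, hxx', irr]
    · fin_cases a <;>
        simp [F4G, F3G, YZEdgeG, SimpleGraph.fromRel_adj, f, hxp, hx'p]
    · fin_cases a <;>
        simp [F4G, F3G, YZEdgeG, SimpleGraph.fromRel_adj, f, hxq, hx'q]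
    · rw [uAdj_comm]
      fin_cases b <;>
        simp [F4G, F3G, YZEdgeG, SimpleGraph.fromRel_adj, f, hxp, hx'p]
    · simp only [F4G, F3G, YZEdgeG, SimpleGraph.sup_adj, SimpleGraph.fromRel_adj, f, Sum.elim_inr,
        Sum.elim_inl, hp _ a.2 _ b.2]
      simp [Fin.ext_iff]; omega
    · simp [F4G, F3G, YZEdgeG, SimpleGraph.fromRel_adj, f, hpq']
    · rw [uAdj_comm]
      fin_cases b <;>
        simp [F4G, F3G, YZEdgeG, SimpleGraph.fromRel_adj, f, hxq, hx'q]
    · rw [uAdj_comm]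
      simp [F4G, F3G, YZEdgeG, SimpleGraph.fromRel_adj, f, hpq']
    · simp only [F4G, F3G, YZEdgeG, SimpleGraph.sup_adj, SimpleGraph.fromRel_adj, f, Sum.elim_inr,
        hq _ a.2 _ b.2]
      simp [Fin.ext_iff]; omega
  · refine hF3 ⟨f, hf, fun a b => ?_⟩
    have hpq' : ∀ i < n, ∀ j < n, ¬ UAdj E (p i) (q j) := by
      intro i hi j hj h
      obtain ⟨rfl, rfl⟩ := hpq i hi j hj h
      exact h0 h
    rw [fromRel_adj_iff_uAdj hE]
    rcases a with a | a | a <;> rcases b with b | b | b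
    · fin_cases a <;> fin_cases b <;>
        simp [F3G, SimpleGraph.fromRel_adj, f, hxx, hxx', irr]
    · fin_cases a <;> simp [F3G, SimpleGraph.fromRel_adj, f, hxp, hx'p]
    · fin_cases a <;> simp [F3G, SimpleGraph.fromRel_adj, f, hxq, hx'q]
    · rw [uAdj_comm]
      fin_cases b <;> simp [F3G, SimpleGraph.fromRel_adj, f, hxp, hx'p]
    · simp only [F3G, SimpleGraph.fromRel_adj, f, Sum.elim_inr, Sum.elim_inl, hp _ a.2 _ b.2]
      simp [Fin.ext_iff]; omega
    · simp [F3G, SimpleGraph.fromRel_adj, f, hpq']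
    · rw [uAdj_comm]
      fin_cases b <;> simp [F3G, SimpleGraph.fromRel_adj, f, hxq, hx'q]
    · rw [uAdj_comm]
      simp [F3G, SimpleGraph.fromRel_adj, f, hpq']
    · simp only [F3G, SimpleGraph.fromRel_adj, f, Sum.elim_inr, hq _ a.2 _ b.2]
      simp [Fin.ext_iff]; omega

/-! ## Induced paths and vertices attached to them -/

/-- The digraph `E` has no 2-cycles and its underlying graph contains none of the graphs
`F^(1)_n, …, F^(4)_n`. -/
structure ArmFree {V : Type} (n : ℕ) (E : V → V → Prop) : Prop where
  three_le : 3 ≤ n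
  asymm : ∀ u v : V, E u v → ¬ E v u
  freeF1 : ¬ HasInducedCopyG (F1G n) (SimpleGraph.fromRel E)
  freeF2 : ¬ HasInducedCopyG (F2G n) (SimpleGraph.fromRel E)
  freeF3 : ¬ HasInducedCopyG (F3G n) (SimpleGraph.fromRel E)
  freeF4 : ¬ HasInducedCopyG (F4G n) (SimpleGraph.fromRel E)

/-- `p 0, …, p (m - 1)` is an induced path of the underlying graph of `E`. -/
structure IndPath {V : Type} (E : V → V → Prop) (p : ℕ → V) (m : ℕ) : Prop where
  inj : ∀ i < m, ∀ j < m, p i = p j → i = j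
  adj : ∀ i < m, ∀ j < m, UAdj E (p i) (p j) ↔ i + 1 = j ∨ j + 1 = i

/-- The sequence `q` with `y` put in front. -/
def consSeq {V : Type} (y : V) (q : ℕ → V) : ℕ → V
  | 0 => y
  | i + 1 => q i

section

variable {V : Type} {E : V → V → Prop} {n m : ℕ} {p : ℕ → V}

theorem IndPath.reverse (hp : IndPath E p m) : IndPath E (fun i => p (m - 1 - i)) m where
  inj i hi j hj h := by
    have := hp.inj _ (by omega) _ (by omega) h
    omega
  adj i hi j hj := by
    rw [hp.adj _ (by omega) _ (by omega)]
    omega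

theorem IndPath.no_pendant (hp : IndPath E p m) (hA : ArmFree n E) {x x' : V} {a b : ℕ}
    (hab : a < b) (ha : n ≤ a + 1) (hb : b + n ≤ m) (hxx : UAdj E x x')
    (hx : ∀ i < m, i ≤ a ∨ b ≤ i → (UAdj E x (p i) ↔ i = a ∨ i = b))
    (hx' : ∀ i < m, i ≤ a ∨ b ≤ i → ¬ UAdj E x' (p i)) : False := by
  refine no_pendant_with_arms hA.asymm hA.three_le hA.freeF1 hA.freeF2
    (p := fun i => p (a - i)) (q := fun i => p (b + i)) hxx ?_ ?_ ?_ ?_ ?_ ?_ ?_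
  · intro i hi
    rw [hx _ (by omega) (by omega)]; omega
  · intro i hi
    rw [hx _ (by omega) (by omega)]; omega
  · intro i hi
    exact hx' _ (by omega) (by omega)
  · intro i hi
    exact hx' _ (by omega) (by omega)
  · intro i hi j hj
    rw [hp.adj _ (by omega) _ (by omega)]; omega
  · intro i hi j hj
    rw [hp.adj _ (by omega) _ (by omega)]; omega
  · intro i hi j hj
    rw [hp.adj _ (by omega) _ (by omega)]; omega

theorem IndPath.no_twins (hp : IndPath E p m) (hA : ArmFree n E) {x x' : V} {a b : ℕ}
    (hab : a < b) (ha : n ≤ a + 1) (hb : b + n ≤ m) (hne : x ≠ x') (hxx : ¬ UAdj E x x')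
    (hx : ∀ i < m, i ≤ a ∨ b ≤ i → (UAdj E x (p i) ↔ i = a ∨ i = b))
    (hx' : ∀ i < m, i ≤ a ∨ b ≤ i → (UAdj E x' (p i) ↔ i = a ∨ i = b)) : False := by
  refine no_twins_with_arms hA.asymm hA.three_le hA.freeF3 hA.freeF4
    (p := fun i => p (a - i)) (q := fun i => p (b + i)) hne hxx ?_ ?_ ?_ ?_ ?_ ?_ ?_
  · intro i hi
    rw [hx _ (by omega) (by omega)]; omega
  · intro i hi
    rw [hx _ (by omega) (by omega)]; omega
  · intro i hi
    rw [hx' _ (by omega) (by omega)]; omega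
  · intro i hi
    rw [hx' _ (by omega) (by omega)]; omega
  · intro i hi j hj
    rw [hp.adj _ (by omega) _ (by omega)]; omega
  · intro i hi j hj
    rw [hp.adj _ (by omega) _ (by omega)]; omega
  · intro i hi j hj
    rw [hp.adj _ (by omega) _ (by omega)]; omega

/-- The variant of `IndPath.no_pendant` in which one arm runs through the vertex `y`. -/
theorem IndPath.no_pendant_through (hp : IndPath E p m) (hA : ArmFree n E) {x x' y : V} {a b : ℕ}
    (hab : a + 2 ≤ b) (ha : n ≤ a + 1) (hb : b + n ≤ m) (hxx : UAdj E x x')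
    (hxy : UAdj E x y) (hx'y : ¬ UAdj E x' y)
    (hx : ∀ i < m, i ≤ a ∨ b ≤ i → (UAdj E x (p i) ↔ i = a))
    (hx' : ∀ i < m, i ≤ a ∨ b ≤ i → ¬ UAdj E x' (p i))
    (hyl : ∀ i < a, ¬ UAdj E y (p i))
    (hyr : ∀ i < m, b ≤ i → (UAdj E y (p i) ↔ i = b)) : False := by
  have h3 := hA.three_le
  have hyy : ¬ UAdj E y y := fun h => h.ne hA.asymm rfl
  refine no_pendant_with_arms hA.asymm hA.three_le hA.freeF1 hA.freeF2
    (p := fun i => p (a - i)) (q := consSeq y fun i => p (b + i)) hxx ?_ ?_ ?_ ?_ ?_ ?_ ?_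
  · intro i hi
    rw [hx _ (by omega) (by omega)]; omega
  · rintro (_ | i) hi
    · simpa [consSeq] using hxy
    · simp only [consSeq]
      rw [hx _ (by omega) (by omega)]; omega
  · intro i hi
    exact hx' _ (by omega) (by omega)
  · rintro (_ | i) hi
    · exact hx'y
    · exact hx' _ (by omega) (by omega)
  · intro i hi j hj
    rw [hp.adj _ (by omega) _ (by omega)]; omega
  · rintro (_ | i) hi (_ | j) hj
    · simpa [consSeq] using hyy
    · simp only [consSeq]
      rw [hyr _ (by omega) (by omega)]; omega
    · simp only [consSeq]
      rw [uAdj_comm, hyr _ (by omega) (by omega)]; omega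
    · simp only [consSeq]
      rw [hp.adj _ (by omega) _ (by omega)]; omega
  · rintro i hi (_ | j) hj h
    · simp only [consSeq] at h
      by_contra hc
      exact hyl _ (by omega) h.symm
    · simp only [consSeq] at h
      rw [hp.adj _ (by omega) _ (by omega)] at h; omega

/-- If the extreme neighbors of `y` on the path are far apart, `y` is adjacent to the successor of
its first neighbor. -/
theorem IndPath.adj_succ_first (hp : IndPath E p m) (hA : ArmFree n E) {y : V} {a b : ℕ}
    (ha : n ≤ a) (hb : b + n + 1 ≤ m) (hab : a + 3 ≤ b)
    (hya : UAdj E y (p a)) (hyb : UAdj E y (p b))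
    (hout : ∀ i < m, UAdj E y (p i) → a ≤ i ∧ i ≤ b) : UAdj E y (p (a + 1)) := by
  have h3 := hA.three_le
  by_contra hc
  refine hp.no_pendant_through hA (x := p a) (x' := p (a + 1)) (y := y) (a := a - 1) (b := b)
    (by omega) (by omega) (by omega) ?_ hya.symm (fun h => hc h.symm) ?_ ?_ ?_ ?_
  · rw [hp.adj _ (by omega) _ (by omega)]; omega
  · intro i hi hi'
    rw [hp.adj _ (by omega) _ (by omega)]; omega
  · intro i hi hi'
    rw [hp.adj _ (by omega) _ (by omega)]; omega
  · intro i hi h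
    have := hout i (by omega) h
    omega
  · intro i hi hi'
    constructor
    · intro h
      have := hout i hi h
      omega
    · rintro rfl
      exact hyb

/-- A vertex all of whose neighbors on an induced path lie far from the ends of the path is
adjacent to two, three or four consecutive vertices of the path. -/
theorem IndPath.neighbors_consecutive (hp : IndPath E p m) (hA : ArmFree n E) {y : V}
    (hy : ∀ i < m, y ≠ p i)
    (hmid : ∀ i < m, UAdj E y (p i) → n ≤ i ∧ i + n + 1 ≤ m)
    (hex : ∃ i < m, UAdj E y (p i)) :
    ∃ a d, 1 ≤ d ∧ d ≤ 3 ∧ n ≤ a ∧ a + d + n + 1 ≤ m ∧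
      ∀ i < m, UAdj E y (p i) ↔ a ≤ i ∧ i ≤ a + d := by
  classical
  have h3 := hA.three_le
  have hyy : ¬ UAdj E y y := fun h => h.ne hA.asymm rfl
  let S := (Finset.range m).filter fun i => UAdj E y (p i)
  have hS : S.Nonempty := by
    obtain ⟨i, hi, h⟩ := hex
    exact ⟨i, by simp [S, hi, h]⟩
  obtain ⟨a, ha, hamin⟩ := S.exists_minimal hS
  obtain ⟨b, hb, hbmax⟩ := S.exists_maximal hS
  have hout : ∀ i < m, UAdj E y (p i) → a ≤ i ∧ i ≤ b := by
    intro i hi h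
    have hiS : i ∈ S := by simp [S, hi, h]
    have h1 := @hamin i hiS
    have h2 := @hbmax i hiS
    omega
  simp only [S, Finset.mem_filter, Finset.mem_range] at ha hb
  obtain ⟨ham, hya⟩ := ha
  obtain ⟨hbm, hyb⟩ := hb
  have hna := (hmid a ham hya).1
  have hnb := (hmid b hbm hyb).2
  have hab := (hout a ham hya).2
  -- the neighborhood is not a single vertex
  have h1 : a < b := by
    by_contra hc
    obtain rfl : a = b := by omega
    refine hp.no_pendant hA (x := p a) (x' := y) (a := a - 1) (b := a + 1) (by omega) (by omega)
      (by omega) hya.symm ?_ ?_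
    · intro i hi hi'
      rw [hp.adj _ (by omega) _ (by omega)]; omega
    · intro i hi hi' h
      have := hout i hi h
      omega
  -- vertices of the path at distance two
  have h2 : b = a + 2 → UAdj E y (p (a + 1)) := by
    intro hb2
    by_contra hc
    refine hp.no_twins hA (x := p (a + 1)) (x' := y) (a := a) (b := b) h1 (by omega)
      (by omega) (hy _ (by omega)).symm (fun h => hc h.symm) ?_ ?_
    · intro i hi hi'
      rw [hp.adj _ (by omega) _ (by omega)]; omega
    · intro i hi hi'
      constructor
      · intro h
        have := hout i hi h
        omega
      · rintro (rfl | rfl)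
        exacts [hya, hyb]
  have h4 : a + 3 ≤ b → UAdj E y (p (a + 1)) := fun h =>
    hp.adj_succ_first hA hna (by omega) h hya hyb hout
  have h5 : a + 3 ≤ b → UAdj E y (p (b - 1)) := by
    intro h
    have := hp.reverse.adj_succ_first hA (y := y) (a := m - 1 - b) (b := m - 1 - a) (by omega)
      (by omega) (by omega) (by convert hyb using 2; omega) (by convert hya using 2; omega) (by
        intro i hi h
        have := hout _ (by omega) h
        omega)
    convert this using 2
    omega
  have h6 : b ≤ a + 3 := by
    by_contra hc
    have hmidc : ∀ c, a + 2 ≤ c → c + 2 ≤ b → ¬ UAdj E y (p c) := by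
      intro c hc1 hc2 hyc
      refine hp.no_pendant hA (x := y) (x' := p c) (a := a) (b := b) (by omega) (by omega)
        (by omega) hyc ?_ ?_
      · intro i hi hi'
        constructor
        · intro h
          have := hout i hi h
          omega
        · rintro (rfl | rfl)
          exacts [hya, hyb]
      · intro i hi hi'
        rw [hp.adj _ (by omega) _ (by omega)]; omega
    refine hp.no_pendant_through hA (x := p (a + 1)) (x' := p (a + 2)) (y := y) (a := a) (b := b)
      (by omega) (by omega) (by omega) ?_ (h4 (by omega)).symm
      (fun h => hmidc (a + 2) le_rfl (by omega) h.symm) ?_ ?_ ?_ ?_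
    · rw [hp.adj _ (by omega) _ (by omega)]; omega
    · intro i hi hi'
      rw [hp.adj _ (by omega) _ (by omega)]; omega
    · intro i hi hi'
      rw [hp.adj _ (by omega) _ (by omega)]; omega
    · intro i hi h
      have := hout i (by omega) h
      omega
    · intro i hi hi'
      constructor
      · intro h
        have := hout i hi h
        omega
      · rintro rfl
        exact hyb
  refine ⟨a, b - a, by omega, by omega, hna, by omega, fun i hi => ⟨fun h => ?_, fun h => ?_⟩⟩
  · have := hout i hi h
    omega
  · obtain rfl | rfl | rfl | h' : i = a ∨ i = b ∨ i = a + 1 ∨ (i = b - 1 ∧ a + 3 ≤ b) := by omega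
    · exact hya
    · exact hyb
    · rcases Nat.lt_or_ge b (a + 3) with h' | h'
      · rcases Nat.lt_or_ge b (a + 2) with h'' | h''
        · obtain rfl : b = a + 1 := by omega
          exact hyb
        · exact h2 (by omega)
      · exact h4 h'
    · rw [h'.1]
      exact h5 h'.2

/-- In a `{D^(1)_n, D^(2)_n, D^(3)_n}`-free digraph, a vertex attached to exactly two consecutive
vertices of an induced directed path can be inserted between them. -/
theorem IndPath.insertable (hp : IndPath E p m) (hE : ∀ u v : V, E u v → ¬ E v u)
    (hD : CondD2 n E) (hdir : ∀ i, i + 1 < m → E (p i) (p (i + 1))) {x : V} {c : ℕ}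
    (hc : n ≤ c + 1) (hcm : c + 1 + n ≤ m) (hcm' : c + 1 < m) (hx : ∀ i < m, x ≠ p i)
    (hadj : ∀ i < m, UAdj E x (p i) ↔ i = c ∨ i = c + 1) :
    E (p c) x ∧ E x (p (c + 1)) := by
  let f : Unit ⊕ Fin n ⊕ Fin n → V :=
    Sum.elim (fun _ => x) (Sum.elim (fun i => p (c - i.val)) (fun i => p (c + 1 + i.val)))
  have hf : Function.Injective f := by
    rintro (a | a | a) (b | b | b) h
    · rfl
    · exact absurd h (hx _ (by omega))
    · exact absurd h (hx _ (by omega))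
    · exact absurd h.symm (hx _ (by omega))
    · have := hp.inj _ (by omega) _ (by omega) h
      simp only [Sum.inr.injEq, Sum.inl.injEq, Fin.ext_iff]
      omega
    · have := hp.inj _ (by omega) _ (by omega) h
      omega
    · exact absurd h.symm (hx _ (by omega))
    · have := hp.inj _ (by omega) _ (by omega) h
      omega
    · have := hp.inj _ (by omega) _ (by omega) h
      simp only [Sum.inr.injEq, Fin.ext_iff]
      omega
  have harc : ∀ i < m, ∀ j < m, E (p i) (p j) ↔ i + 1 = j := by
    intro i hi j hj
    constructor
    · intro h
      rcases (hp.adj i hi j hj).1 (Or.inl h) with h' | h'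
      · exact h'
      · subst h'
        exact absurd h (hE _ _ (hdir j hi))
    · rintro rfl
      exact hdir i hj
  have hxc : UAdj E x (p c) := (hadj c (by omega)).2 (Or.inl rfl)
  have hxd : UAdj E x (p (c + 1)) := (hadj _ hcm').2 (Or.inr rfl)
  have hxx : ¬ E x x := fun h => hE _ _ h h
  have h1 : ∀ i < m, i ≠ c → i ≠ c + 1 → ¬ E x (p i) := fun i hi h h' hh => by
    have := (hadj i hi).1 (Or.inl hh)
    omega
  have h2 : ∀ i < m, i ≠ c → i ≠ c + 1 → ¬ E (p i) x := fun i hi h h' hh => by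
    have := (hadj i hi).1 (Or.inr hh)
    omega
  have hyz : ∀ a b : Fin n,
      (E (p (c - a.val)) (p (c - b.val)) ↔ b.val + 1 = a.val) ∧
      (E (p (c - a.val)) (p (c + 1 + b.val)) ↔ a.val = 0 ∧ b.val = 0) ∧
      (¬ E (p (c + 1 + a.val)) (p (c - b.val))) ∧
      (E (p (c + 1 + a.val)) (p (c + 1 + b.val)) ↔ a.val + 1 = b.val) := by
    intro a b
    refine ⟨?_, ?_, ?_, ?_⟩ <;> rw [harc _ (by omega) _ (by omega)] <;> omega
  have e1 : ∀ a : Fin n, E x (p (c - a.val)) ↔ a.val = 0 ∧ E x (p c) := by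
    intro a
    rcases Nat.eq_zero_or_pos a.val with h0 | h0
    · simp [h0]
    · simpa [h0.ne'] using h1 (c - a.val) (by omega) (by omega) (by omega)
  have e2 : ∀ a : Fin n, E (p (c - a.val)) x ↔ a.val = 0 ∧ E (p c) x := by
    intro a
    rcases Nat.eq_zero_or_pos a.val with h0 | h0
    · simp [h0]
    · simpa [h0.ne'] using h2 (c - a.val) (by omega) (by omega) (by omega)
  have e3 : ∀ a : Fin n, E x (p (c + 1 + a.val)) ↔ a.val = 0 ∧ E x (p (c + 1)) := by
    intro a
    rcases Nat.eq_zero_or_pos a.val with h0 | h0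
    · simp [h0]
    · simpa [h0.ne'] using h1 (c + 1 + a.val) (by omega) (by omega) (by omega)
  have e4 : ∀ a : Fin n, E (p (c + 1 + a.val)) x ↔ a.val = 0 ∧ E (p (c + 1)) x := by
    intro a
    rcases Nat.eq_zero_or_pos a.val with h0 | h0
    · simp [h0]
    · simpa [h0.ne'] using h2 (c + 1 + a.val) (by omega) (by omega) (by omega)
  rcases hxc with hxc | hxc <;> rcases hxd with hxd | hxd
  · refine absurd ⟨f, hf, ?_⟩ hD.2.1
    rintro (a | a | a) (b | b | b) <;>
      simp [f, D2Rel, hyz, e1, e2, e3, e4, hxx, hxc, hxd, hE _ _ hxc, hE _ _ hxd]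
  · refine absurd ⟨f, hf, ?_⟩ hD.1
    rintro (a | a | a) (b | b | b) <;>
      simp [f, D1Rel, hyz, e1, e2, e3, e4, hxx, hxc, hxd, hE _ _ hxc, hE _ _ hxd]
  · exact ⟨hxc, hxd⟩
  · refine absurd ⟨f, hf, ?_⟩ hD.2.2
    rintro (a | a | a) (b | b | b) <;>
      simp [f, D3Rel, hyz, e1, e2, e3, e4, hxx, hxc, hxd, hE _ _ hxc, hE _ _ hxd]

end

/-! ## Rerouting an induced path through an attached vertex -/

/-- The vertex `y` lies outside the path `p 0, …, p (m - 1)` and is adjacent to exactly its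
consecutive vertices `p a, …, p (a + d)`, which are far from the ends of the path. -/
structure Attached {V : Type} (E : V → V → Prop) (p : ℕ → V) (m n : ℕ) (y : V) (a d : ℕ) :
    Prop where
  ne : ∀ i < m, y ≠ p i
  one_le : 1 ≤ d
  le_three : d ≤ 3
  le_start : n ≤ a
  end_le : a + d + n + 1 ≤ m
  adj : ∀ i < m, UAdj E y (p i) ↔ a ≤ i ∧ i ≤ a + d

/-- The sequence obtained from `p` by replacing the vertices strictly between `p a` and
`p (a + d)` by the single vertex `y`. -/
def rerouted {V : Type} (p : ℕ → V) (y : V) (a d : ℕ) (i : ℕ) : V :=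
  if i ≤ a then p i else if i = a + 1 then y else p (i + d - 2)

/-- The arcs between the attached vertex `y` and its extreme neighbors on the path are directed
along the path. -/
def Through {V : Type} (E : V → V → Prop) (p : ℕ → V) (y : V) (a d : ℕ) : Prop :=
  E (p a) y ∧ E y (p (a + d))

section

variable {V : Type} {E : V → V → Prop} {n m a d a' d' : ℕ} {p : ℕ → V} {y z : V}

theorem IndPath.reroute (hp : IndPath E p m) (hE : ∀ u v : V, E u v → ¬ E v u)
    (hy : Attached E p m n y a d) (hd : 2 ≤ d) : IndPath E (rerouted p y a d) (m + 2 - d) where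
  inj i hi j hj h := by
    have h3 := hy.le_three
    have h4 := hy.end_le
    unfold rerouted at h
    split_ifs at h
    · exact hp.inj _ (by omega) _ (by omega) h
    · exact absurd h.symm (hy.ne _ (by omega))
    · have := hp.inj _ (by omega) _ (by omega) h
      omega
    · exact absurd h (hy.ne _ (by omega))
    · omega
    · exact absurd h (hy.ne _ (by omega))
    · have := hp.inj _ (by omega) _ (by omega) h
      omega
    · exact absurd h.symm (hy.ne _ (by omega))
    · have := hp.inj _ (by omega) _ (by omega) h
      omega
  adj i hi j hj := by
    have h3 := hy.le_three
    have h4 := hy.end_le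
    have hyy : ¬ UAdj E y y := fun h => h.ne hE rfl
    unfold rerouted
    split_ifs
    · exact hp.adj _ (by omega) _ (by omega)
    · rw [uAdj_comm, hy.adj _ (by omega)]; omega
    · rw [hp.adj _ (by omega) _ (by omega)]; omega
    · rw [hy.adj _ (by omega)]; omega
    · exact iff_of_false hyy (by omega)
    · rw [hy.adj _ (by omega)]; omega
    · rw [hp.adj _ (by omega) _ (by omega)]; omega
    · rw [uAdj_comm, hy.adj _ (by omega)]; omega
    · rw [hp.adj _ (by omega) _ (by omega)]; omega

theorem reroute_directed (hdir : ∀ i, i + 1 < m → E (p i) (p (i + 1)))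
    (hy : Attached E p m n y a d) (hd : 2 ≤ d) (ht : Through E p y a d) :
    ∀ i, i + 1 < m + 2 - d → E (rerouted p y a d i) (rerouted p y a d (i + 1)) := by
  intro i hi
  have h3 := hy.le_three
  have h4 := hy.end_le
  unfold rerouted
  split_ifs
  · exact hdir _ (by omega)
  · obtain rfl : i = a := by omega
    exact ht.1
  · omega
  · omega
  · omega
  · obtain rfl : i = a + 1 := by omega
    have := ht.2
    convert this using 2
    omega
  · omega
  · omega
  · have := hdir (i + d - 2) (by omega)
    convert this using 2
    omega

/-- The neighbors, on the path rerouted through `y`, of an attached vertex not adjacent to `y`. -/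
theorem Attached.uAdj_reroute (hy : Attached E p m n y a d) (hz : Attached E p m n z a' d')
    (hd : 2 ≤ d) (hyz : ¬ UAdj E y z) {i : ℕ} (hi : i < m + 2 - d) :
    UAdj E z (rerouted p y a d i) ↔
      (i ≤ a ∧ a' ≤ i ∧ i ≤ a' + d') ∨ (a + 2 ≤ i ∧ a' ≤ i + d - 2 ∧ i + d - 2 ≤ a' + d') := by
  have h3 := hy.le_three
  have h4 := hy.end_le
  unfold rerouted
  split_ifs
  · rw [hz.adj _ (by omega)]; omega
  · exact iff_of_false (fun h => hyz h.symm) (by omega)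
  · rw [hz.adj _ (by omega)]; omega

theorem Attached.ne_reroute (hy : Attached E p m n y a d) (hz : Attached E p m n z a' d')
    (hd : 2 ≤ d) (hne : y ≠ z) : ∀ i < m + 2 - d, z ≠ rerouted p y a d i := by
  intro i hi
  have h3 := hy.le_three
  have h4 := hy.end_le
  unfold rerouted
  split_ifs
  · exact hz.ne _ (by omega)
  · exact hne.symm
  · exact hz.ne _ (by omega)

/-- An attached vertex not adjacent to `y` is adjacent to consecutive vertices of the path rerouted
through `y`. -/
theorem Attached.reroute (hp : IndPath E p m) (hA : ArmFree n E) (hy : Attached E p m n y a d)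
    (hz : Attached E p m n z a' d') (hd : 2 ≤ d) (hne : y ≠ z) (hyz : ¬ UAdj E y z)
    (hex : ∃ i < m + 2 - d, UAdj E z (rerouted p y a d i)) :
    ∃ b e, Attached E (rerouted p y a d) (m + 2 - d) n z b e := by
  have h3 := hy.le_three
  have h4 := hy.end_le
  have h5 := hy.le_start
  have h6 := hz.end_le
  have h7 := hz.le_start
  obtain ⟨b, e, k1, k2, k3, k4, k5⟩ := (hp.reroute hA.asymm hy hd).neighbors_consecutive hA
    (hy.ne_reroute hz hd hne) (fun i hi h => by
      rw [hy.uAdj_reroute hz hd hyz hi] at h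
      omega) hex
  exact ⟨b, e, hy.ne_reroute hz hd hne, k1, k2, k3, k4, k5⟩

/-- An attached vertex not adjacent to `y` misses one of the extreme neighbors of `y`. -/
theorem Attached.uAdj_of_covers (hp : IndPath E p m) (hA : ArmFree n E)
    (hy : Attached E p m n y a d) (hz : Attached E p m n z a' d') (hd : 2 ≤ d) (hne : y ≠ z)
    (h1 : a' ≤ a) (h2 : a + d ≤ a' + d') : UAdj E y z := by
  by_contra hyz
  have h3 := hy.le_three
  have h4 := hy.end_le
  have key := fun i hi => hy.uAdj_reroute hz hd hyz (i := i) hi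
  obtain ⟨b, e, hb⟩ := hy.reroute hp hA hz hd hne hyz
    ⟨a, by omega, (key a (by omega)).2 (by omega)⟩
  have e1 := (key a (by omega)).symm.trans (hb.adj a (by omega))
  have e2 := (key (a + 1) (by omega)).symm.trans (hb.adj (a + 1) (by omega))
  have e3 := (key (a + 2) (by omega)).symm.trans (hb.adj (a + 2) (by omega))
  omega

theorem Attached.uAdj_of_same_start (hp : IndPath E p m) (hA : ArmFree n E)
    (hy : Attached E p m n y a d) (hz : Attached E p m n z a d') (hd : 2 ≤ d) (hd' : 2 ≤ d')
    (hne : y ≠ z) : UAdj E y z := by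
  rcases le_total d d' with h | h
  · exact hy.uAdj_of_covers hp hA hz hd hne le_rfl (by omega)
  · exact (hz.uAdj_of_covers hp hA hy hd' hne.symm le_rfl (by omega)).symm

/-- Vertices attached to disjoint parts of the path are not adjacent. -/
theorem Attached.not_uAdj_of_lt (hp : IndPath E p m) (hA : ArmFree n E)
    (hy : Attached E p m n y a d) (hz : Attached E p m n z a' d') (hd : 2 ≤ d)
    (h : a + d < a') : ¬ UAdj E y z := by
  intro hyz
  have h3 := hy.le_three
  have h4 := hy.end_le
  have h5 := hy.le_start
  have h6 := hz.end_le
  have h7 := hz.le_start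
  have h8 := hz.one_le
  refine hp.no_pendant_through hA (x := y) (x' := p (a + d)) (y := z) (a := a) (b := a' + d')
    (by omega) (by omega) (by omega) ?_ hyz ?_ ?_ ?_ ?_ ?_
  · rw [hy.adj _ (by omega)]; omega
  · rw [uAdj_comm, hz.adj _ (by omega)]; omega
  · intro i hi hi'
    rw [hy.adj _ (by omega)]; omega
  · intro i hi hi'
    rw [hp.adj _ (by omega) _ (by omega)]; omega
  · intro i hi
    rw [hz.adj _ (by omega)]; omega
  · intro i hi hi'
    rw [hz.adj _ (by omega)]; omega

theorem Attached.through_of_one (hp : IndPath E p m) (hE : ∀ u v : V, E u v → ¬ E v u)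
    (hD : CondD2 n E) (hdir : ∀ i, i + 1 < m → E (p i) (p (i + 1)))
    (hy : Attached E p m n y a 1) : Through E p y a 1 := by
  have h4 := hy.end_le
  have h5 := hy.le_start
  refine hp.insertable hE hD hdir (by omega) (by omega) (by omega) hy.ne fun i hi => ?_
  rw [hy.adj i hi]; omega

/-- The orientation of the arcs between the path and a vertex with four neighbors on it. -/
theorem Attached.arcs_of_three (hp : IndPath E p m) (hE : ∀ u v : V, E u v → ¬ E v u)
    (hD : CondD2 n E) (hdir : ∀ i, i + 1 < m → E (p i) (p (i + 1)))
    (hy : Attached E p m n y a 3) (ht : Through E p y a 3) :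
    E (p (a + 1)) y ∧ E y (p (a + 2)) := by
  have h4 := hy.end_le
  have h5 := hy.le_start
  have hr := hp.reroute hE hy (by omega)
  have hrd := reroute_directed hdir hy (by omega) ht
  have hne : ∀ k, k = 1 ∨ k = 2 → ∀ i < m + 2 - 3, p (a + k) ≠ rerouted p y a 3 i := by
    intro k hk i hi h
    unfold rerouted at h
    split_ifs at h
    · have := hp.inj _ (by omega) _ (by omega) h
      omega
    · exact hy.ne _ (by omega) h.symm
    · have := hp.inj _ (by omega) _ (by omega) h
      omega
  have hadj : ∀ k, k = 1 ∨ k = 2 → ∀ i < m + 2 - 3,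
      (UAdj E (p (a + k)) (rerouted p y a 3 i) ↔ i = a + k - 1 ∨ i = a + k) := by
    intro k hk i hi
    unfold rerouted
    split_ifs
    · rw [hp.adj _ (by omega) _ (by omega)]; omega
    · rw [uAdj_comm, hy.adj _ (by omega)]; omega
    · rw [hp.adj _ (by omega) _ (by omega)]; omega
  have e1 := hr.insertable hE hD hrd (x := p (a + 1)) (c := a) (by omega) (by omega) (by omega)
    (hne 1 (by omega)) (hadj 1 (by omega))
  have e2 := hr.insertable hE hD hrd (x := p (a + 2)) (c := a + 1) (by omega) (by omega) (by omega)
    (hne 2 (by omega)) (hadj 2 (by omega))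
  have e3 : rerouted p y a 3 (a + 1) = y := by simp [rerouted]
  rw [e3] at e1 e2
  exact ⟨e1.2, e2.1⟩

/-- `c` is the first position at which `y` can be inserted into the directed path `p`. -/
def IsFirstSlot {V : Type} (E : V → V → Prop) (p : ℕ → V) (y : V) (c : ℕ) : Prop :=
  (E (p c) y ∧ E y (p (c + 1))) ∧ ∀ b < c, ¬ (E (p b) y ∧ E y (p (b + 1)))

/-- Two attached vertices, directed along the path and sharing their first slot, are adjacent. -/
theorem Attached.uAdj_of_same_slot (hp : IndPath E p m) (hA : ArmFree n E) (hD : CondD2 n E)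
    (hdir : ∀ i, i + 1 < m → E (p i) (p (i + 1)))
    (hy : Attached E p m n y a d) (hz : Attached E p m n z a' d')
    (hty : Through E p y a d) (htz : Through E p z a' d')
    {c : ℕ} (hcm : c + 1 < m) (hcy : IsFirstSlot E p y c) (hcz : IsFirstSlot E p z c)
    (hne : y ≠ z) : UAdj E y z := by
  have hE := hA.asymm
  -- a vertex with four neighbors on the path is inserted between the two middle ones
  have mid : ∀ {w : V} {b : ℕ}, Attached E p m n w b 3 → Through E p w b 3 →
      IsFirstSlot E p w c → c = b + 1 := by
    intro w b hw htw hcw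
    have e := hw.arcs_of_three hp hE hD hdir htw
    have e1 := (hw.adj c (by omega)).1 (Or.inr hcw.1.1)
    have e2 := (hw.adj (c + 1) hcm).1 (Or.inl hcw.1.2)
    by_contra hc
    obtain rfl | rfl : c = b ∨ c = b + 2 := by omega
    · exact hE _ _ e.1 hcw.1.2
    · exact hE _ _ e.2 hcw.1.1
  have shift : ∀ {w w' : V} {b : ℕ}, Attached E p m n w b 2 → Attached E p m n w' (b + 1) 2 →
      Through E p w' (b + 1) 2 → IsFirstSlot E p w c → c = b + 1 → w ≠ w' → UAdj E w w' := by
    intro w w' b hw hw' htw' hcw hcb hww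
    by_contra hnot
    have hnot' : ¬ UAdj E w' w := fun h => hnot h.symm
    have h1 := hw.end_le
    have h2 := hw.le_start
    have h1' := hw'.end_le
    have e := (hp.reroute hE hw' le_rfl).insertable hE hD (reroute_directed hdir hw' le_rfl htw')
      (x := w) (c := b) (by omega) (by omega) (by omega) (hw'.ne_reroute hw le_rfl hww.symm)
      (fun i hi => by
        rw [hw'.uAdj_reroute hw le_rfl hnot' hi]; omega)
    have e1 : rerouted p w' (b + 1) 2 b = p b := by simp [rerouted]
    have e2 : rerouted p w' (b + 1) 2 (b + 1) = p (b + 1) := by simp [rerouted]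
    rw [e1, e2] at e
    exact hcw.2 b (by omega) e
  wlog hdd : d ≤ d' generalizing y z a d a' d'
  · exact (this hz hy htz hty hcz hcy hne.symm (by omega)).symm
  have s1 := (hy.adj c (by omega)).1 (Or.inr hcy.1.1)
  have s2 := (hy.adj (c + 1) hcm).1 (Or.inl hcy.1.2)
  have s3 := (hz.adj c (by omega)).1 (Or.inr hcz.1.1)
  have s4 := (hz.adj (c + 1) hcm).1 (Or.inl hcz.1.2)
  have y1 := hy.one_le
  have y2 := hy.le_three
  have y3 := hy.le_start
  have y4 := hy.end_le
  have z1 := hz.one_le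
  have z2 := hz.le_three
  have z3 := hz.le_start
  have z4 := hz.end_le
  by_contra hyz
  have hzy : ¬ UAdj E z y := fun h => hyz h.symm
  obtain ⟨rfl, rfl⟩ | ⟨rfl, rfl⟩ | ⟨rfl, rfl⟩ | ⟨rfl, rfl⟩ | ⟨rfl, hd'⟩ | ⟨rfl, rfl⟩ :
      (d = 1 ∧ d' = 1) ∨ (d = 1 ∧ d' = 2) ∨ (d = 1 ∧ d' = 3) ∨ (d = 2 ∧ d' = 2) ∨
      (d' = 3 ∧ d = 2) ∨ (d = 3 ∧ d' = 3) := by omega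
  · obtain rfl : a = c := by omega
    obtain rfl : a' = a := by omega
    refine hp.no_twins hA (a := a') (b := a' + 1) (by omega) (by omega) (by omega) hne hyz ?_ ?_
    · intro i hi hi'
      rw [hy.adj i hi]; omega
    · intro i hi hi'
      rw [hz.adj i hi]; omega
  · have key := fun i hi => hz.uAdj_reroute hy le_rfl hzy (i := i) hi
    obtain ⟨b, e, hb⟩ := hz.reroute hp hA hy le_rfl hne.symm hzy (by
      rcases Nat.lt_or_ge a' c with h | h
      · exact ⟨c + 1, by omega, (key _ (by omega)).2 (by omega)⟩
      · exact ⟨c, by omega, (key _ (by omega)).2 (by omega)⟩)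
    have b1 := hb.one_le
    have b2 := hb.end_le
    have e1 := (key b (by omega)).symm.trans (hb.adj b (by omega))
    have e2 := (key (b + 1) (by omega)).symm.trans (hb.adj (b + 1) (by omega))
    omega
  · have := mid hz htz hcz
    refine hp.no_pendant_through hA (x := p (a' + 1)) (x' := y) (y := z) (a := a') (b := a' + 3)
      (by omega) (by omega) (by omega) ?_ ?_ hyz ?_ ?_ ?_ ?_
    · rw [uAdj_comm, hy.adj _ (by omega)]; omega
    · rw [uAdj_comm, hz.adj _ (by omega)]; omega
    · intro i hi hi'
      rw [hp.adj _ (by omega) _ (by omega)]; omega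
    · intro i hi hi'
      rw [hy.adj _ (by omega)]; omega
    · intro i hi
      rw [hz.adj _ (by omega)]; omega
    · intro i hi hi'
      rw [hz.adj _ (by omega)]; omega
  · obtain rfl | rfl | rfl : a = a' ∨ a' = a + 1 ∨ a = a' + 1 := by omega
    · exact hyz (hy.uAdj_of_same_start hp hA hz le_rfl le_rfl hne)
    · exact hyz (shift hy hz htz hcy (by omega) hne)
    · exact hzy (shift hz hy hty hcz (by omega) hne.symm)
  · have := mid hz htz hcz
    subst hd'
    exact hyz (hy.uAdj_of_covers hp hA hz le_rfl hne (by omega) (by omega))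
  · have m1 := mid hz htz hcz
    have m2 := mid hy hty hcy
    exact hyz (hy.uAdj_of_covers hp hA hz (by omega) hne (by omega) (by omega))

end

/-! ## Counting turns of induced pseudo-paths -/

/-- The vertex `q (j + 1)` has in-degree or out-degree two in the pseudo-path `q`. -/
def IsTurn {V : Type} (E : V → V → Prop) (q : ℕ → V) (j : ℕ) : Prop :=
  (E (q (j + 1)) (q j) ∧ E (q (j + 1)) (q (j + 2))) ∨
    (E (q j) (q (j + 1)) ∧ E (q (j + 2)) (q (j + 1)))

/-- There is an induced pseudo-path with at least `t` turns that ends with `p e, p (e + 1)` and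
otherwise consists of vertices `p j` with `j ≤ e` and of vertices all of whose neighbors on the
path `p` precede `p (e + 1)`. -/
def TurningPath {V : Type} (E : V → V → Prop) (p : ℕ → V) (m n e t : ℕ) : Prop :=
  ∃ (q : ℕ → V) (k : ℕ) (S : Finset ℕ), IndPath E q (k + 2) ∧ q k = p e ∧ q (k + 1) = p (e + 1) ∧
    t ≤ S.card ∧ (∀ j ∈ S, j < k ∧ IsTurn E q j) ∧
    ∀ i < k + 1, (∃ j ≤ e, q i = p j) ∨ ∃ a d, Attached E p m n (q i) a d ∧ 2 ≤ d ∧ a + d ≤ e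

section

variable {V : Type} {E : V → V → Prop} {n m a d e t k : ℕ} {p q : ℕ → V} {x y : V}

theorem IsTurn.congr {q' : ℕ → V} {j : ℕ} (h : IsTurn E q j) (hk : j + 2 < k)
    (hq : ∀ i < k, q' i = q i) : IsTurn E q' j := by
  unfold IsTurn
  rwa [hq _ (by omega), hq _ (by omega), hq _ (by omega)]

theorem IndPath.card_turns_le (hq : IndPath E q k) (h3 : CondD3 n E) {S : Finset ℕ}
    (hS : ∀ j ∈ S, j + 2 < k ∧ IsTurn E q j) : S.card ≤ n := by
  classical
  refine le_trans ?_ (h3 k (fun i => q i) ⟨fun i j h => Fin.ext (hq.inj i i.2 j j.2 h),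
    fun i j => hq.adj i i.2 j j.2⟩)
  have hinj : Set.InjOn (fun j : S => (⟨j + 1, by have := (hS j j.2).1; omega⟩ : Fin k))
      (Set.univ : Set S) := fun i _ j _ h => by
    have := congrArg Fin.val h
    exact Subtype.ext (by simpa using this)
  rw [turnCount, ← Fintype.card_coe, ← Nat.card_eq_fintype_card, ← Set.ncard_univ,
    ← hinj.ncard_image]
  refine Set.ncard_le_ncard ?_ (Set.toFinite _)
  rintro _ ⟨j, -, rfl⟩
  obtain ⟨h1, h2⟩ := hS j j.2
  exact ⟨⟨j, by omega⟩, ⟨j + 2, h1⟩, rfl, rfl, h2⟩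

/-- An induced path can be extended by a vertex adjacent to its last vertex only. -/
theorem IndPath.exists_snoc (hq : IndPath E q k) (hE : ∀ u v : V, E u v → ¬ E v u)
    (hne : ∀ i < k, x ≠ q i) (hx : ∀ i < k, UAdj E x (q i) ↔ i + 1 = k) :
    ∃ q', IndPath E q' (k + 1) ∧ (∀ i < k, q' i = q i) ∧ q' k = x := by
  have h1 : ∀ i < k, Function.update q k x i = q i := fun i hi =>
    Function.update_of_ne (by omega) _ _
  have h2 : Function.update q k x k = x := Function.update_self _ _ _
  refine ⟨_, ⟨fun i hi j hj h => ?_, fun i hi j hj => ?_⟩, h1, h2⟩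
  · rcases Nat.lt_succ_iff_lt_or_eq.1 hi with hi | rfl <;>
      rcases Nat.lt_succ_iff_lt_or_eq.1 hj with hj | rfl
    · rw [h1 i hi, h1 j hj] at h
      exact hq.inj i hi j hj h
    · rw [h1 i hi, h2] at h
      exact absurd h.symm (hne i hi)
    · rw [h1 j hj, h2] at h
      exact absurd h (hne j hj)
    · rfl
  · rcases Nat.lt_succ_iff_lt_or_eq.1 hi with hi | rfl <;>
      rcases Nat.lt_succ_iff_lt_or_eq.1 hj with hj | rfl
    · rw [h1 i hi, h1 j hj, hq.adj i hi j hj]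
    · rw [h1 i hi, h2, uAdj_comm, hx i hi]
      omega
    · rw [h1 j hj, h2, hx j hj]
      omega
    · rw [h2]
      exact ⟨fun h => absurd rfl (h.ne hE), by omega⟩

theorem TurningPath.zero (hp : IndPath E p m) (hm : 1 < m) : TurningPath E p m n 0 0 :=
  ⟨p, 0, ∅, ⟨fun i hi j hj => hp.inj i (by omega) j (by omega),
    fun i hi j hj => hp.adj i (by omega) j (by omega)⟩, rfl, rfl, le_rfl, by simp,
    fun i hi => Or.inl ⟨i, by omega, rfl⟩⟩

theorem TurningPath.succ (h : TurningPath E p m n e t) (hp : IndPath E p m)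
    (hE : ∀ u v : V, E u v → ¬ E v u) (he : e + 2 < m) : TurningPath E p m n (e + 1) t := by
  obtain ⟨q, k, S, hq, h0, h1, ht, hS, hV⟩ := h
  obtain ⟨q', hq', hlt, hk⟩ := hq.exists_snoc (x := p (e + 2)) hE
    (fun i hi => by
      rcases Nat.lt_succ_iff_lt_or_eq.1 hi with hi | rfl
      · rcases hV i hi with ⟨j, hj, hij⟩ | ⟨a, d, hy, hd, had⟩
        · rw [hij]
          exact fun h => absurd (hp.inj _ he _ (by omega) h) (by omega)
        · exact (hy.ne _ he).symm
      · rw [h1]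
        exact fun h => absurd (hp.inj _ he _ (by omega) h) (by omega))
    (fun i hi => by
      rcases Nat.lt_succ_iff_lt_or_eq.1 hi with hi | rfl
      · rcases hV i hi with ⟨j, hj, hij⟩ | ⟨a, d, hy, hd, had⟩
        · rw [hij, hp.adj _ he _ (by omega)]
          omega
        · rw [uAdj_comm, hy.adj _ he]
          omega
      · rw [h1, hp.adj _ he _ (by omega)]
        omega)
  refine ⟨q', k + 1, S, hq', by rw [hlt _ (by omega), h1], hk, ht,
    fun j hj => ?_, fun i hi => ?_⟩
  · have := (hS j hj).1
    exact ⟨by omega, (hS j hj).2.congr (by omega) hlt⟩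
  rw [hlt i (by omega)]
  rcases Nat.lt_succ_iff_lt_or_eq.1 hi with hi | rfl
  · rcases hV i hi with ⟨j, hj, hij⟩ | ⟨a, d, hy, hd, had⟩
    · exact Or.inl ⟨j, by omega, hij⟩
    · exact Or.inr ⟨a, d, hy, hd, by omega⟩
  · exact Or.inl ⟨e + 1, le_rfl, h1⟩

theorem TurningPath.mono (h : TurningPath E p m n e t) (hp : IndPath E p m)
    (hE : ∀ u v : V, E u v → ¬ E v u) {e' : ℕ} (hee : e ≤ e') (he : e' + 1 < m) :
    TurningPath E p m n e' t := by
  induction e', hee using Nat.le_induction with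
  | base => exact h
  | succ k hk ih => exact (ih (by omega)).succ hp hE he

/-- Walking through a vertex that is not directed along the path yields two turns. -/
theorem TurningPath.detour (h : TurningPath E p m n e t) (hp : IndPath E p m) (hA : ArmFree n E)
    (hdir : ∀ i, i + 1 < m → E (p i) (p (i + 1))) (hy : Attached E p m n y (e + 1) d)
    (hd : 2 ≤ d) (hbad : ¬ Through E p y (e + 1) d) :
    TurningPath E p m n (e + 1 + d) (t + 2) := by
  have hE := hA.asymm
  have hm := hy.end_le
  have h3n := hA.three_le
  obtain ⟨q, k, S, hq, h0, h1, ht, hS, hV⟩ := h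
  have hV' : ∀ i < k + 2, (∃ j ≤ e + 1, q i = p j) ∨
      ∃ a d, Attached E p m n (q i) a d ∧ 2 ≤ d ∧ a + d ≤ e := by
    intro i hi
    rcases Nat.lt_succ_iff_lt_or_eq.1 hi with hi | rfl
    · rcases hV i hi with ⟨j, hj, hij⟩ | h
      · exact Or.inl ⟨j, by omega, hij⟩
      · exact Or.inr h
    · exact Or.inl ⟨e + 1, le_rfl, h1⟩
  -- append `y`
  obtain ⟨q₁, hq₁, hlt₁, hk₁⟩ := hq.exists_snoc (x := y) hE
    (fun i hi => by
      rcases hV' i hi with ⟨j, hj, hij⟩ | ⟨a, d, hz, hd, had⟩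
      · rw [hij]
        exact hy.ne _ (by omega)
      · rintro rfl
        have h1 := (hy.adj a (by omega)).1 ((hz.adj a (by omega)).2 (by omega))
        omega)
    (fun i hi => by
      rcases Nat.lt_succ_iff_lt_or_eq.1 hi with hi | rfl
      · rcases hV i hi with ⟨j, hj, hij⟩ | ⟨a, d', hz, hd', had⟩
        · rw [hij, hy.adj _ (by omega)]
          omega
        · exact ⟨fun h => absurd h.symm (hz.not_uAdj_of_lt hp hA hy hd' (by omega)), by omega⟩
      · rw [h1, hy.adj _ (by omega)]
        omega)
  -- append the last neighbor of `y`
  obtain ⟨q₂, hq₂, hlt₂, hk₂⟩ := hq₁.exists_snoc (x := p (e + 1 + d)) hE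
    (fun i hi => by
      rcases Nat.lt_succ_iff_lt_or_eq.1 hi with hi | rfl
      · rw [hlt₁ i hi]
        rcases hV' i hi with ⟨j, hj, hij⟩ | ⟨a, d', hz, hd', had⟩
        · rw [hij]
          exact fun h => absurd (hp.inj _ (by omega) _ (by omega) h) (by omega)
        · exact (hz.ne _ (by omega)).symm
      · rw [hk₁]
        exact (hy.ne _ (by omega)).symm)
    (fun i hi => by
      rcases Nat.lt_succ_iff_lt_or_eq.1 hi with hi | rfl
      · rw [hlt₁ i hi]
        rcases hV' i hi with ⟨j, hj, hij⟩ | ⟨a, d', hz, hd', had⟩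
        · rw [hij, hp.adj _ (by omega) _ (by omega)]
          omega
        · rw [uAdj_comm, hz.adj _ (by omega)]
          omega
      · rw [hk₁, uAdj_comm, hy.adj _ (by omega)]
        omega)
  have hold : ∀ i < k + 2, q₂ i = q i := fun i hi => by rw [hlt₂ i (by omega), hlt₁ i hi]
  have hy₂ : q₂ (k + 2) = y := by rw [hlt₂ _ (by omega), hk₁]
  -- append the next vertex of the path
  obtain ⟨q₃, hq₃, hlt₃, hk₃⟩ := hq₂.exists_snoc (x := p (e + 1 + d + 1)) hE
    (fun i hi => by
      rcases Nat.lt_succ_iff_lt_or_eq.1 hi with hi | rfl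
      · rcases Nat.lt_succ_iff_lt_or_eq.1 hi with hi | rfl
        · rw [hold i hi]
          rcases hV' i hi with ⟨j, hj, hij⟩ | ⟨a, d', hz, hd', had⟩
          · rw [hij]
            exact fun h => absurd (hp.inj _ (by omega) _ (by omega) h) (by omega)
          · exact (hz.ne _ (by omega)).symm
        · rw [hy₂]
          exact (hy.ne _ (by omega)).symm
      · rw [hk₂]
        exact fun h => absurd (hp.inj _ (by omega) _ (by omega) h) (by omega))
    (fun i hi => by
      rcases Nat.lt_succ_iff_lt_or_eq.1 hi with hi | rfl
      · rcases Nat.lt_succ_iff_lt_or_eq.1 hi with hi | rfl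
        · rw [hold i hi]
          rcases hV' i hi with ⟨j, hj, hij⟩ | ⟨a, d', hz, hd', had⟩
          · rw [hij, hp.adj _ (by omega) _ (by omega)]
            omega
          · rw [uAdj_comm, hz.adj _ (by omega)]
            omega
        · rw [hy₂, uAdj_comm, hy.adj _ (by omega)]
          omega
      · rw [hk₂, hp.adj _ (by omega) _ (by omega)]
        omega)
  have hold₃ : ∀ i < k + 2, q₃ i = q i := fun i hi => by rw [hlt₃ i (by omega), hold i hi]
  have e0 : q₃ k = p e := by rw [hold₃ _ (by omega), h0]
  have e1 : q₃ (k + 1) = p (e + 1) := by rw [hold₃ _ (by omega), h1]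
  have e2 : q₃ (k + 2) = y := by rw [hlt₃ _ (by omega), hy₂]
  have e3 : q₃ (k + 3) = p (e + 1 + d) := by rw [hlt₃ _ (by omega), hk₂]
  have e4 : q₃ (k + 4) = p (e + 1 + d + 1) := hk₃
  have a0 : E (p e) (p (e + 1)) := hdir e (by omega)
  have a1 : UAdj E y (p (e + 1)) := (hy.adj _ (by omega)).2 (by omega)
  have a2 : UAdj E y (p (e + 1 + d)) := (hy.adj _ (by omega)).2 (by omega)
  have a3 : E (p (e + 1 + d)) (p (e + 1 + d + 1)) := hdir _ (by omega)
  have turns : ∃ u w, k ≤ u ∧ u < w ∧ w < k + 3 ∧ IsTurn E q₃ u ∧ IsTurn E q₃ w := by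
    have t0 : E y (p (e + 1)) → IsTurn E q₃ k := fun h => by
      unfold IsTurn
      rw [e0, e1, e2]
      exact Or.inr ⟨a0, h⟩
    have t1 : E y (p (e + 1)) → E y (p (e + 1 + d)) → IsTurn E q₃ (k + 1) := fun h h' => by
      unfold IsTurn
      rw [e1, e2, e3]
      exact Or.inl ⟨h, h'⟩
    have t1' : E (p (e + 1)) y → E (p (e + 1 + d)) y → IsTurn E q₃ (k + 1) := fun h h' => by
      unfold IsTurn
      rw [e1, e2, e3]
      exact Or.inr ⟨h, h'⟩
    have t2 : E (p (e + 1 + d)) y → IsTurn E q₃ (k + 2) := fun h => by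
      unfold IsTurn
      rw [e2, e3, e4]
      exact Or.inl ⟨h, a3⟩
    rcases a1 with a1 | a1 <;> rcases a2 with a2 | a2
    · exact ⟨k, k + 1, by omega, by omega, by omega, t0 a1, t1 a1 a2⟩
    · exact ⟨k, k + 2, by omega, by omega, by omega, t0 a1, t2 a2⟩
    · exact absurd ⟨a1, a2⟩ hbad
    · exact ⟨k + 1, k + 2, by omega, by omega, by omega, t1' a1 a2, t2 a2⟩
  obtain ⟨u, w, hku, huw, hwk, hu, hw⟩ := turns
  refine ⟨q₃, k + 3, insert u (insert w S), hq₃, e3, e4, ?_, ?_, ?_⟩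
  · rw [Finset.card_insert_of_notMem, Finset.card_insert_of_notMem]
    · omega
    · exact fun h => by have := (hS w h).1; omega
    · rw [Finset.mem_insert]
      rintro (h | h)
      · omega
      · have := (hS u h).1
        omega
  · intro j hj
    rcases Finset.mem_insert.1 hj with rfl | hj
    · exact ⟨by omega, hu⟩
    rcases Finset.mem_insert.1 hj with rfl | hj
    · exact ⟨by omega, hw⟩
    · have := (hS j hj).1
      exact ⟨by omega, (hS j hj).2.congr (k := k + 2) (by omega) hold₃⟩
  · intro i hi
    rcases Nat.lt_succ_iff_lt_or_eq.1 hi with hi | rfl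
    · rcases Nat.lt_succ_iff_lt_or_eq.1 hi with hi | rfl
      · rw [hold₃ i hi]
        rcases hV' i hi with ⟨j, hj, hij⟩ | ⟨a, d', hz, hd', had⟩
        · exact Or.inl ⟨j, by omega, hij⟩
        · exact Or.inr ⟨a, d', hz, hd', by omega⟩
      · rw [e2]
        exact Or.inr ⟨_, _, hy, hd, le_rfl⟩
    · exact Or.inl ⟨_, le_rfl, e3⟩

/-- The attached vertices not directed along the path start at no more than `2 * n` different
positions. -/
theorem IndPath.card_starts_le (hp : IndPath E p m) (hA : ArmFree n E) (h3 : CondD3 n E)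
    (hdir : ∀ i, i + 1 < m → E (p i) (p (i + 1))) {A : Finset ℕ}
    (hstart : ∀ a ∈ A, ∃ y d, Attached E p m n y a d ∧ 2 ≤ d ∧ ¬ Through E p y a d) :
    A.card ≤ 2 * n := by
  have hE := hA.asymm
  have h3n := hA.three_le
  have key : ∀ e, e + 1 < m →
      TurningPath E p m n e (2 * (A.filter fun a => a % 4 = (e + 1) % 4 ∧ a < e + 1).card) := by
    intro e
    induction e using Nat.strong_induction_on with
    | _ e ih =>
      intro he
      rcases lt_or_ge e 4 with h4 | h4
      · rw [Finset.filter_eq_empty_iff.2, Finset.card_empty]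
        · exact (TurningPath.zero hp (by omega)).mono hp hE (by omega) he
        · intro a ha hlt
          obtain ⟨y, d, hy, -⟩ := hstart a ha
          have := hy.le_start
          omega
      · obtain ⟨f, rfl⟩ := Nat.exists_eq_add_of_le' h4
        have hf := ih f (by omega) (by omega)
        by_cases hfA : f + 1 ∈ A
        · obtain ⟨y, d, hy, hd, hbad⟩ := hstart _ hfA
          have h5 := hy.le_three
          have hcard : (A.filter fun a => a % 4 = (f + 4 + 1) % 4 ∧ a < f + 4 + 1).card =
              (A.filter fun a => a % 4 = (f + 1) % 4 ∧ a < f + 1).card + 1 := by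
            rw [← Finset.card_insert_of_notMem (a := f + 1) (by simp)]
            congr 1
            ext a
            simp only [Finset.mem_filter, Finset.mem_insert]
            constructor
            · rintro ⟨h1, h2⟩
              by_cases h : a = f + 1
              · exact Or.inl h
              · exact Or.inr ⟨h1, by omega⟩
            · rintro (rfl | ⟨h1, h2⟩)
              · exact ⟨hfA, by omega⟩
              · exact ⟨h1, by omega⟩
          rw [hcard, mul_add]
          exact (hf.detour hp hA hdir hy hd hbad).mono hp hE (by omega) he
        · have hfilter : (A.filter fun a => a % 4 = (f + 4 + 1) % 4 ∧ a < f + 4 + 1) =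
              A.filter fun a => a % 4 = (f + 1) % 4 ∧ a < f + 1 := by
            refine Finset.filter_congr fun a ha => ?_
            have : a ≠ f + 1 := fun h => hfA (h ▸ ha)
            omega
          rw [hfilter]
          exact hf.mono hp hE (by omega) he
  have hfiber : ∀ r ∈ Finset.range 4, (A.filter fun a => a % 4 = r).card ≤ n / 2 := by
    intro r _
    rcases (A.filter fun a => a % 4 = r).eq_empty_or_nonempty with h | h
    · simp [h]
    obtain ⟨M, hM, hmax⟩ := Finset.exists_max_image _ id h
    rw [Finset.mem_filter] at hM
    obtain ⟨y, d, hy, hd, -⟩ := hstart M hM.1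
    have h4 := hy.end_le
    obtain ⟨q, k, S, hq, -, -, ht, hS, -⟩ := key (M + 3) (by omega)
    have hsub : (A.filter fun a => a % 4 = r) ⊆
        A.filter fun a => a % 4 = (M + 3 + 1) % 4 ∧ a < M + 3 + 1 := by
      intro a ha
      have h1 := hmax a ha
      rw [Finset.mem_filter] at ha ⊢
      simp only [id] at h1
      exact ⟨ha.1, by omega⟩
    have h5 := Finset.card_le_card hsub
    have h6 := hq.card_turns_le h3 fun j hj => ⟨by have := (hS j hj).1; omega, (hS j hj).2⟩
    omega
  have := Finset.card_le_mul_card_image_of_maps_to (f := (· % 4)) (s := A) (t := Finset.range 4)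
    (fun a _ => Finset.mem_range.2 (Nat.mod_lt _ (by omega))) (n / 2) hfiber
  rw [Finset.card_range] at this
  omega

end

/-! ## Path partitions -/

section

variable {V : Type} {E : V → V → Prop} {n m a d : ℕ} {p : ℕ → V} {y : V}

theorem exists_insert_isChain {z : V} {L : List V} (hL : L.IsChain E)
    (hz : ∀ x ∈ L, UAdj E z x) : ∃ L' : List V, L'.Perm (z :: L) ∧ L'.IsChain E ∧
      (L'.head? = some z ∨ L'.head? = L.head?) := by
  induction L with
  | nil => exact ⟨[z], List.Perm.refl _, List.isChain_singleton _, Or.inl rfl⟩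
  | cons x L ih =>
    rcases hz x List.mem_cons_self with h | h
    · exact ⟨z :: x :: L, List.Perm.refl _, List.isChain_cons_cons.2 ⟨h, hL⟩, Or.inl rfl⟩
    · rw [List.isChain_cons] at hL
      obtain ⟨L', hperm, hchain, hhead⟩ := ih hL.2 fun w hw => hz w (List.mem_cons_of_mem _ hw)
      refine ⟨x :: L', (hperm.cons x).trans (List.Perm.swap _ _ _), ?_, Or.inr rfl⟩
      rw [List.isChain_cons]
      refine ⟨fun w hw => ?_, hchain⟩
      rcases hhead with hh | hh <;> rw [hh] at hw
      · rw [Option.mem_some_iff] at hw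
        exact hw ▸ h
      · exact hL.1 w hw

/-- Rédei's theorem: every tournament has a Hamiltonian directed path. -/
theorem exists_isChain_of_tournament (S : Finset V)
    (hS : ∀ x ∈ S, ∀ y ∈ S, x ≠ y → UAdj E x y) :
    ∃ L : List V, L.Nodup ∧ L.IsChain E ∧ ∀ x, x ∈ L ↔ x ∈ S := by
  classical
  induction S using Finset.induction_on with
  | empty => exact ⟨[], List.nodup_nil, List.isChain_nil, by simp⟩
  | insert z S hz ih =>
    obtain ⟨L, hnd, hch, hmem⟩ := ih fun x hx y hy =>
      hS x (Finset.mem_insert_of_mem hx) y (Finset.mem_insert_of_mem hy)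
    obtain ⟨L', hperm, hch', -⟩ := exists_insert_isChain (z := z) hch fun x hx =>
      hS z (Finset.mem_insert_self _ _) x (Finset.mem_insert_of_mem ((hmem x).1 hx))
        fun h => hz (h ▸ (hmem x).1 hx)
    refine ⟨L', hperm.nodup_iff.2 (List.nodup_cons.2 ⟨fun h => hz ((hmem z).1 h), hnd⟩), hch',
      fun x => ?_⟩
    rw [hperm.mem_iff, List.mem_cons, Finset.mem_insert, hmem]

theorem ppOn_le_of_family {ι : Type} {X : Set V} (I : Finset ι) (F : ι → List V)
    (hnd : ∀ i ∈ I, (F i).Nodup) (hch : ∀ i ∈ I, (F i).IsChain E)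
    (hX : ∀ x, x ∈ X ↔ ∃ i ∈ I, x ∈ F i)
    (hdis : ∀ i ∈ I, ∀ j ∈ I, i ≠ j → ∀ x ∈ F i, x ∉ F j) : ppOn E X ≤ I.card := by
  classical
  refine le_trans (Nat.sInf_le ⟨(I.image F).erase [], rfl, ?_, ?_, ?_⟩)
    ((Finset.card_erase_le).trans Finset.card_image_le)
  · intro L hL
    obtain ⟨hne, hL⟩ := Finset.mem_erase.1 hL
    obtain ⟨i, hi, rfl⟩ := Finset.mem_image.1 hL
    exact ⟨⟨hne, hnd i hi, hch i hi⟩, fun x hx => (hX x).2 ⟨i, hi, hx⟩⟩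
  · intro x hx
    obtain ⟨i, hi, hxi⟩ := (hX x).1 hx
    exact ⟨F i, Finset.mem_erase.2 ⟨List.ne_nil_of_mem hxi, Finset.mem_image_of_mem _ hi⟩, hxi⟩
  · intro L hL L' hL' hne
    obtain ⟨i, hi, rfl⟩ := Finset.mem_image.1 (Finset.mem_of_mem_erase hL)
    obtain ⟨j, hj, rfl⟩ := Finset.mem_image.1 (Finset.mem_of_mem_erase hL')
    exact hdis i hi j hj fun h => hne (congrArg F h)

/-- Vertices with given slots can be inserted into a directed path, provided that vertices sharing
a slot are adjacent. -/
theorem exists_isChain_insert_slots (hp : IndPath E p m)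
    (hdir : ∀ i, i + 1 < m → E (p i) (p (i + 1))) (G : Finset V) (σ : V → ℕ)
    (hne : ∀ y ∈ G, ∀ i < m, y ≠ p i)
    (hσ : ∀ y ∈ G, E (p (σ y)) y ∧ E y (p (σ y + 1)))
    (hadj : ∀ y ∈ G, ∀ z ∈ G, σ y = σ z → y ≠ z → UAdj E y z) (s k : ℕ) (hsk : s + k < m) :
    ∃ L : List V, L.Nodup ∧ L.IsChain E ∧ L.getLast? = some (p (s + k)) ∧
      ∀ x, x ∈ L ↔ (∃ i, s ≤ i ∧ i ≤ s + k ∧ x = p i) ∨ (x ∈ G ∧ s ≤ σ x ∧ σ x < s + k) := by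
  classical
  induction k with
  | zero =>
    refine ⟨[p s], List.nodup_singleton _, List.isChain_singleton _, rfl, fun x => ?_⟩
    rw [List.mem_singleton]
    constructor
    · exact fun h => Or.inl ⟨s, le_rfl, le_rfl, h⟩
    · rintro (⟨i, h1, h2, rfl⟩ | ⟨-, h1, h2⟩)
      · congr 1
        omega
      · omega
  | succ k ih =>
    obtain ⟨L, hnd, hch, hlast, hmem⟩ := ih (by omega)
    obtain ⟨T, hndT, hchT, hmemT⟩ := exists_isChain_of_tournament (E := E)
      (G.filter fun y => σ y = s + k) fun y hy z hz hyz => by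
        rw [Finset.mem_filter] at hy hz
        exact hadj y hy.1 z hz.1 (hy.2.trans hz.2.symm) hyz
    simp only [Finset.mem_filter] at hmemT
    refine ⟨L ++ (T ++ [p (s + k + 1)]), ?_, ?_, by simp [add_assoc], fun x => ?_⟩
    · rw [List.nodup_append, List.nodup_append]
      refine ⟨hnd, ⟨hndT, List.nodup_singleton _, ?_⟩, ?_⟩
      · rintro x hx w hw rfl
        rw [List.mem_singleton] at hw
        exact hne x ((hmemT x).1 hx).1 _ (by omega) hw
      · rintro x hx w hw rfl
        rw [List.mem_append, List.mem_singleton, hmemT] at hw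
        rw [hmem] at hx
        rcases hx with ⟨i, h1, h2, rfl⟩ | ⟨h1, h2, h3⟩ <;> rcases hw with ⟨h4, h5⟩ | h4
        · exact hne _ h4 i (by omega) rfl
        · exact absurd (hp.inj _ (by omega) _ (by omega) h4) (by omega)
        · omega
        · exact hne x h1 _ (by omega) h4
    · rw [List.isChain_append, List.isChain_append]
      refine ⟨hch, ⟨hchT, List.isChain_singleton _, fun x hx w hw => ?_⟩, fun x hx w hw => ?_⟩
      · have hxT := (hmemT x).1 (List.mem_of_mem_getLast? hx)
        have hw : w = p (s + k + 1) := by simpa [eq_comm] using hw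
        rw [hw, ← hxT.2]
        exact (hσ x hxT.1).2
      · rw [hlast, Option.mem_some_iff] at hx
        rw [← hx]
        have hw := List.mem_of_mem_head? hw
        rw [List.mem_append, List.mem_singleton, hmemT] at hw
        rcases hw with ⟨h1, h2⟩ | rfl
        · rw [← h2]
          exact (hσ w h1).1
        · exact hdir _ (by omega)
    · rw [List.mem_append, List.mem_append, List.mem_singleton, hmemT, hmem]
      constructor
      · rintro ((⟨i, h1, h2, rfl⟩ | ⟨h1, h2, h3⟩) | ⟨h1, h2⟩ | rfl)
        · exact Or.inl ⟨i, h1, by omega, rfl⟩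
        · exact Or.inr ⟨h1, h2, by omega⟩
        · exact Or.inr ⟨h1, by omega, by omega⟩
        · exact Or.inl ⟨_, by omega, le_rfl, rfl⟩
      · rintro (⟨i, h1, h2, rfl⟩ | ⟨h1, h2, h3⟩)
        · rcases Nat.le_succ_iff.1 h2 with h | rfl
          · exact Or.inl (Or.inl ⟨i, h1, h, rfl⟩)
          · exact Or.inr (Or.inr rfl)
        · rcases Nat.lt_succ_iff_lt_or_eq.1 h3 with h | h
          · exact Or.inl (Or.inr ⟨h1, h2, h⟩)
          · exact Or.inr (Or.inl ⟨h1, h⟩)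

theorem Attached.exists_isFirstSlot (hy : Attached E p m n y a d) (ht : Through E p y a d) :
    ∃ c, IsFirstSlot E p y c ∧ n ≤ c ∧ c + n + 2 ≤ m := by
  classical
  have hm := hy.end_le
  have hex : ∀ f, 1 ≤ f → f ≤ d → E y (p (a + f)) →
      ∃ c, (E (p c) y ∧ E y (p (c + 1))) ∧ c + 1 ≤ a + d := by
    intro f hf
    induction f, hf using Nat.le_induction with
    | base => exact fun hfd h => ⟨a, ⟨ht.1, h⟩, by omega⟩
    | succ f hf ih =>
      intro hfd h
      rcases (hy.adj (a + f) (by omega)).2 (by omega) with h' | h'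
      · exact ih (by omega) h'
      · exact ⟨a + f, ⟨h', h⟩, by omega⟩
  obtain ⟨c, hc, hca⟩ := hex d hy.one_le le_rfl ht.2
  have hfind : ∃ c, E (p c) y ∧ E y (p (c + 1)) := ⟨c, hc⟩
  have hle : Nat.find hfind ≤ c := Nat.find_le hc
  have hstart := ((hy.adj (Nat.find hfind) (by omega)).1 (Or.inr (Nat.find_spec hfind).1)).1
  have := hy.le_start
  exact ⟨Nat.find hfind, ⟨Nat.find_spec hfind, fun b hb => Nat.find_min hfind hb⟩, by omega,
    by omega⟩

/-- A segment of an induced directed path missing at most one end vertex, together with attached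
vertices, has a small path partition. -/
theorem IndPath.ppOn_le [Fintype V] (hp : IndPath E p m) (hA : ArmFree n E) (hD : CondD2 n E)
    (h3 : CondD3 n E) (hdir : ∀ i, i + 1 < m → E (p i) (p (i + 1))) {Y : Set V}
    (hY : ∀ y ∈ Y, ∃ a d, Attached E p m n y a d) {s k : ℕ} (hs : s ≤ 1) (hsk : s + k < m)
    (hmk : m ≤ s + k + 2) :
    ppOn E ({x | ∃ i, s ≤ i ∧ i ≤ s + k ∧ x = p i} ∪ Y) ≤ 2 * n + 1 := by
  classical
  have hE := hA.asymm
  have h3n := hA.three_le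
  choose! a d hatt using hY
  have hslot : ∀ y, y ∈ Y → Through E p y (a y) (d y) →
      ∃ c, IsFirstSlot E p y c ∧ n ≤ c ∧ c + n + 2 ≤ m :=
    fun y hy ht => (hatt y hy).exists_isFirstSlot ht
  choose! σ hσ using hslot
  have hd : ∀ y ∈ Y, ¬ Through E p y (a y) (d y) → 2 ≤ d y := by
    intro y hy ht
    have h := hatt y hy
    by_contra hlt
    have h1 : d y = 1 := by
      have := h.one_le
      omega
    rw [h1] at h ht
    exact ht (h.through_of_one hp hE hD hdir)
  let G : Finset V := Finset.univ.filter fun y => y ∈ Y ∧ Through E p y (a y) (d y)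
  let B : Finset V := Finset.univ.filter fun y => y ∈ Y ∧ ¬ Through E p y (a y) (d y)
  have memG : ∀ y, y ∈ G ↔ y ∈ Y ∧ Through E p y (a y) (d y) := fun y => by simp [G]
  have memB : ∀ y, y ∈ B ↔ y ∈ Y ∧ ¬ Through E p y (a y) (d y) := fun y => by simp [B]
  obtain ⟨L, hndL, hchL, -, hmemL⟩ := exists_isChain_insert_slots hp hdir G σ
    (fun y hy => (hatt y ((memG y).1 hy).1).ne)
    (fun y hy => (hσ y ((memG y).1 hy).1 ((memG y).1 hy).2).1.1)
    (fun y hy z hz hyz hne => by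
      rw [memG] at hy hz
      have h1 := hσ y hy.1 hy.2
      have h2 := hσ z hz.1 hz.2
      exact (hatt y hy.1).uAdj_of_same_slot hp hA hD hdir (hatt z hz.1) hy.2 hz.2 (c := σ y)
        (by omega) h1.1 (hyz ▸ h2.1) hne) s k hsk
  have hT : ∀ α : ℕ, ∃ T : List V, T.Nodup ∧ T.IsChain E ∧ ∀ x, x ∈ T ↔ x ∈ B ∧ a x = α := by
    intro α
    obtain ⟨T, h1, h2, h3⟩ := exists_isChain_of_tournament (E := E) (B.filter fun y => a y = α)
      fun y hy z hz hyz => by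
        rw [Finset.mem_filter, memB] at hy hz
        have h1 := hatt y hy.1.1
        have h2 := hatt z hz.1.1
        rw [hy.2] at h1
        rw [hz.2] at h2
        exact h1.uAdj_of_same_start hp hA h2 (hd y hy.1.1 hy.1.2) (hd z hz.1.1 hz.1.2) hyz
    exact ⟨T, h1, h2, fun x => by rw [h3, Finset.mem_filter]⟩
  choose T hndT hchT hmemT using hT
  have hLB : ∀ x, x ∈ L → x ∉ B := by
    intro x hx hxB
    rw [memB] at hxB
    rcases (hmemL x).1 hx with ⟨i, h1, h2, rfl⟩ | ⟨h1, -⟩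
    · exact (hatt _ hxB.1).ne i (by omega) rfl
    · exact hxB.2 ((memG x).1 h1).2
  have hcard : (B.image a).card ≤ 2 * n := by
    refine hp.card_starts_le hA h3 hdir fun α hα => ?_
    obtain ⟨y, hy, rfl⟩ := Finset.mem_image.1 hα
    rw [memB] at hy
    exact ⟨y, d y, hatt y hy.1, hd y hy.1 hy.2, hy.2⟩
  refine le_trans (ppOn_le_of_family (E := E) (Finset.insertNone (B.image a))
    (fun o => o.elim L T) ?_ ?_ ?_ ?_) (by rw [Finset.card_insertNone]; omega)
  · rintro (_ | α) _
    exacts [hndL, hndT α]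
  · rintro (_ | α) _
    exacts [hchL, hchT α]
  · intro x
    constructor
    · rintro (hx | hx)
      · exact ⟨none, Finset.none_mem_insertNone, (hmemL x).2 (Or.inl hx)⟩
      · by_cases ht : Through E p x (a x) (d x)
        · have h1 := (hσ x hx ht).2
          exact ⟨none, Finset.none_mem_insertNone,
            (hmemL x).2 (Or.inr ⟨(memG x).2 ⟨hx, ht⟩, by omega, by omega⟩)⟩
        · have hxB := (memB x).2 ⟨hx, ht⟩
          exact ⟨some (a x), Finset.some_mem_insertNone.2 (Finset.mem_image_of_mem a hxB),
            (hmemT (a x) x).2 ⟨hxB, rfl⟩⟩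
    · rintro ⟨_ | α, -, hx⟩
      · rcases (hmemL x).1 hx with h | ⟨h, -⟩
        · exact Or.inl h
        · exact Or.inr ((memG x).1 h).1
      · exact Or.inr ((memB x).1 ((hmemT α x).1 hx).1).1
  · rintro (_ | α) _ (_ | β) _ hne x hx hx'
    · exact hne rfl
    · exact hLB x hx ((hmemT β x).1 hx').1
    · exact hLB x hx' ((hmemT α x).1 hx).1
    · exact hne (congrArg some (((hmemT α x).1 hx).2.symm.trans ((hmemT β x).1 hx').2))

end

/-- Let `n ≥ 3` and let `D` satisfy (D'1), (D2), (D3).  Let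
`Q = v₁⋯v_l` be an induced directed path of `D` and `Y' ⊆ N_{G_D}(V(Q))` with
`N_{G_D}(y) ∩ V(Q) ⊆ {v_{n+1}, …, v_{l−n}}` for all `y ∈ Y'`.  Then
`pp(D[V(Q) ∪ Y']) ≤ n(n+5)/2 + 1`, and also
`pp(D[(V(Q) ∖ {v_t}) ∪ Y']) ≤ n(n+5)/2 + 1` for `t ∈ {1, l}`.  (Indices are 0-based.) -/
theorem pp_of_induced_dirpath_with_neighbors (n : ℕ) (hn : 3 ≤ n)
    (V : Type) [Fintype V] (E : V → V → Prop)
    (hE : ∀ u v : V, E u v → ¬ E v u)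
    (h1 : CondD1' n E) (h2 : CondD2 n E) (h3 : CondD3 n E)
    (l : ℕ) (hl : 0 < l) (v : Fin l → V)
    (hQind : IsInducedPsPath E v)
    (hQdir : ∀ i j : Fin l, i.val + 1 = j.val → E (v i) (v j))
    (Y' : Set V)
    (hY' : ∀ y ∈ Y', y ∉ Set.range v ∧ ∃ i : Fin l, (SimpleGraph.fromRel E).Adj y (v i))
    (hmid : ∀ y ∈ Y', ∀ i : Fin l, (SimpleGraph.fromRel E).Adj y (v i) →
      n ≤ i.val ∧ i.val + n + 1 ≤ l) :
    ppOn E (Set.range v ∪ Y') ≤ n * (n + 5) / 2 + 1 ∧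
    ppOn E ((Set.range v \ {v ⟨0, hl⟩}) ∪ Y') ≤ n * (n + 5) / 2 + 1 ∧
    ppOn E ((Set.range v \ {v ⟨l - 1, Nat.sub_lt hl Nat.one_pos⟩}) ∪ Y') ≤
      n * (n + 5) / 2 + 1 := by
  have hA : ArmFree n E :=
    ⟨hn, hE, h1.1.2.2.1, h1.1.2.2.2, h1.2.1, h1.2.2⟩
  obtain ⟨p, hpv⟩ : ∃ p : ℕ → V, ∀ i : Fin l, v i = p i :=
    ⟨fun i => if h : i < l then v ⟨i, h⟩ else v ⟨0, hl⟩, fun i => by simp⟩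
  have hp : IndPath E p l :=
    ⟨fun i hi j hj h => by
      rw [← hpv ⟨i, hi⟩, ← hpv ⟨j, hj⟩] at h
      exact congrArg Fin.val (hQind.1 h),
    fun i hi j hj => by
      rw [← hpv ⟨i, hi⟩, ← hpv ⟨j, hj⟩]
      exact hQind.2 ⟨i, hi⟩ ⟨j, hj⟩⟩
  have hdir : ∀ i, i + 1 < l → E (p i) (p (i + 1)) := fun i hi => by
    have h := hQdir ⟨i, by omega⟩ ⟨i + 1, hi⟩ rfl
    rwa [hpv, hpv] at h
  have hY : ∀ y ∈ Y', ∃ a d, Attached E p l n y a d := fun y hy => by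
    have hne : ∀ i < l, y ≠ p i := fun i hi h =>
      (hY' y hy).1 ⟨⟨i, hi⟩, (hpv ⟨i, hi⟩).trans h.symm⟩
    obtain ⟨i, hi⟩ := (hY' y hy).2
    rw [fromRel_adj_iff_uAdj hE, hpv] at hi
    obtain ⟨a, d, h1, h2, h3, h4, h5⟩ := hp.neighbors_consecutive hA hne
      (fun j hj h => hmid y hy ⟨j, hj⟩ ((fromRel_adj_iff_uAdj hE).2 (by rwa [hpv])))
      ⟨i, i.2, hi⟩
    exact ⟨a, d, hne, h1, h2, h3, h4, h5⟩
  have hbound : 2 * n + 1 ≤ n * (n + 5) / 2 + 1 := by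
    have : 2 * n * 2 ≤ n * (n + 5) := by nlinarith
    omega
  have hrange : Set.range v = {x | ∃ i < l, x = p i} := by
    ext x
    constructor
    · rintro ⟨i, rfl⟩
      exact ⟨i, i.2, hpv i⟩
    · rintro ⟨i, hi, rfl⟩
      exact ⟨⟨i, hi⟩, hpv ⟨i, hi⟩⟩
  have hdiff : ∀ t (ht : t < l), Set.range v \ {v ⟨t, ht⟩} = {x | ∃ i < l, i ≠ t ∧ x = p i} := by
    intro t ht
    rw [hrange, hpv]
    ext x
    constructor
    · rintro ⟨⟨i, hi, rfl⟩, hne⟩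
      exact ⟨i, hi, fun h => hne (congrArg p h), rfl⟩
    · rintro ⟨i, hi, hne, rfl⟩
      exact ⟨⟨i, hi, rfl⟩, fun h => hne (hp.inj i hi t ht h)⟩
  have hseg : ∀ (s k : ℕ) (X : Set V), s ≤ 1 → s + k < l → l ≤ s + k + 2 →
      (∀ x, x ∈ X ↔ ∃ i, s ≤ i ∧ i ≤ s + k ∧ x = p i) →
      ppOn E (X ∪ Y') ≤ n * (n + 5) / 2 + 1 := by
    intro s k X hs hsk hk hX
    obtain rfl : X = {x | ∃ i, s ≤ i ∧ i ≤ s + k ∧ x = p i} := Set.ext hX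
    exact (hp.ppOn_le hA h2 h3 hdir hY hs hsk hk).trans hbound
  rw [hdiff 0 hl, hdiff (l - 1) (Nat.sub_lt hl Nat.one_pos), hrange]
  refine ⟨hseg 0 (l - 1) _ (by omega) (by omega) (by omega) fun x => ?_, ?_⟩
  · exact exists_congr fun i => by rw [← and_assoc]; exact and_congr_left fun _ => by omega
  rcases Nat.lt_or_ge 1 l with hl1 | hl1
  · exact ⟨hseg 1 (l - 2) _ (by omega) (by omega) (by omega) fun x => exists_congr fun i => by
        rw [← and_assoc, ← and_assoc]; exact and_congr_left fun _ => by omega,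
      hseg 0 (l - 2) _ (by omega) (by omega) (by omega) fun x => exists_congr fun i => by
        rw [← and_assoc, ← and_assoc]; exact and_congr_left fun _ => by omega⟩
  · have hempty : ∀ t, t = 0 → ppOn E ({x | ∃ i < l, i ≠ t ∧ x = p i} ∪ Y') ≤
        n * (n + 5) / 2 + 1 := by
      intro t ht
      refine (ppOn_le_of_family (∅ : Finset Unit) (fun _ => []) (by simp) (by simp) ?_
        (by simp)).trans (Nat.zero_le _)
      intro x
      constructor
      · rintro (⟨i, hi, hit, -⟩ | hx)
        · omega
        · obtain ⟨a, d, h⟩ := hY x hx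
          have := h.end_le
          omega
      · rintro ⟨i, hi, -⟩
        simp at hi
    exact ⟨hempty 0 rfl, hempty (l - 1) (by omega)⟩
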